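/- arXiv:2310.07214 — 2 statements merged into one kernel-verified Lean document; each statement's English description precedes it below -/
import Mathlib

section
/- Let G be a finite simple graph that is odd-hole-free and has maximum degree Δ(G) ≥ 9. Then the chromatic number of G satisfies χ(G) ≤ max{Δ(G) − 1, ω(G)}, where ω(G) is the clique number of G. -/
/-- `G` has an *odd hole*: an induced cycle of odd length at least 5
(a hole is an induced cycle of length at least 4, so odd holes have length at least 5). -/
def SimpleGraph.HasOddHole {V : Type*} (G : SimpleGraph V) : Prop :=
  ∃ n : ℕ, Odd n ∧ 5 ≤ n ∧ Nonempty (SimpleGraph.cycleGraph n ↪g G)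

section Aux
open Finset

def POff {V : Type*} {n : ℕ} (G : SimpleGraph V) (f : V → Fin n) (T : Finset V) : Prop :=
  ∀ a b, a ∉ T → b ∉ T → G.Adj a b → f a ≠ f b

open Classical in
lemma ext_hall {V : Type*} {n : ℕ} (G : SimpleGraph V) (f : V → Fin n)
    (T A : Finset V) (hf : POff G f T)
    (hall : ∀ S ⊆ A, S.Nonempty → ∀ D : Finset (Fin n),
      (∀ u ∈ S, ∀ d ∈ D, ∃ p, p ∉ T ∧ G.Adj u p ∧ f p = d) → S.card + D.card ≤ n) :
    ∃ f' : V → Fin n, POff G f' (T \ A) ∧ (∀ p, p ∉ A → f' p = f p) ∧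
      (∀ a ∈ A, ∀ b ∈ A, f' a = f' b → a = b) := by
  let t : A → Finset (Fin n) := fun u =>
    univ.filter (fun c => ∀ p, p ∉ T → G.Adj u p → f p ≠ c)
  have key : ∃ g : A → Fin n, Function.Injective g ∧ ∀ x, g x ∈ t x := by
    rw [← Finset.all_card_le_biUnion_card_iff_exists_injective]
    intro s
    rcases s.eq_empty_or_nonempty with rfl | hs
    · simp
    have h1 := hall (s.map (Function.Embedding.subtype _)) (by
        intro x hx
        simp only [mem_map, Function.Embedding.subtype_apply] at hx
        obtain ⟨a, _, rfl⟩ := hx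
        exact a.2) (by simpa using hs) (s.biUnion t)ᶜ (by
        intro u hu d hd
        simp only [mem_map, Function.Embedding.subtype_apply] at hu
        obtain ⟨a, ha, rfl⟩ := hu
        simp only [mem_compl, mem_biUnion, not_exists, not_and] at hd
        have := hd a ha
        simp only [t, mem_filter, mem_univ, true_and] at this
        push Not at this
        obtain ⟨p, h1, h2, h3⟩ := this
        exact ⟨p, h1, h2, h3⟩)
    rw [card_map, card_compl, Fintype.card_fin] at h1
    have : (s.biUnion t).card ≤ n := by
      simpa using card_le_univ (s.biUnion t)
    omega
  obtain ⟨g, hg, hgt⟩ := key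
  have hgt' : ∀ (x : A) p, p ∉ T → G.Adj x p → f p ≠ g x := by
    intro x
    have := hgt x
    simpa only [t, mem_filter, mem_univ, true_and] using this
  refine ⟨fun p => if h : p ∈ A then g ⟨p, h⟩ else f p, ?_, ?_, ?_⟩
  · intro a b ha hb hab
    by_cases h1 : a ∈ A <;> by_cases h2 : b ∈ A
    · simp only [h1, h2, dif_pos]
      intro h
      have := hg h
      simp only [Subtype.mk.injEq] at this
      exact hab.ne this
    · have hb' : b ∉ T := fun h => hb (by simp [h, h2])
      simp only [h1, h2, dif_pos, dif_neg, not_false_eq_true]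
      exact fun h => hgt' ⟨a, h1⟩ b hb' hab h.symm
    · have ha' : a ∉ T := fun h => ha (by simp [h, h1])
      simp only [h1, h2, dif_pos, dif_neg, not_false_eq_true]
      exact hgt' ⟨b, h2⟩ a ha' hab.symm
    · have hb' : b ∉ T := fun h => hb (by simp [h, h2])
      have ha' : a ∉ T := fun h => ha (by simp [h, h1])
      simp only [h1, h2, dif_neg, not_false_eq_true]
      exact hf a b ha' hb' hab
  · intro p hp
    simp [hp]
  · intro a ha b hb h
    simp only [ha, hb, dif_pos] at h
    simpa using hg h

lemma kempe {V : Type*} {n : ℕ} (G : SimpleGraph V) (hfree : ¬ ∃ n : ℕ, Odd n ∧ 5 ≤ n ∧ Nonempty (SimpleGraph.cycleGraph n ↪g G))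
    (hnot : ∀ f : V → Fin n, ¬ ∀ a b, G.Adj a b → f a ≠ f b)
    (v : V) (f : V → Fin n) (hf : ∀ a b, a ≠ v → b ≠ v → G.Adj a b → f a ≠ f b)
    (a : V) (hva : G.Adj v a) (ha : ∀ b, G.Adj v b → f b = f a → b = a)
    (i : Fin n) (hi : i ≠ f a) : ∃ x, G.Adj v x ∧ f x = i ∧ G.Adj a x := by
  classical
  let H : SimpleGraph V :=
    { Adj := fun p q => G.Adj p q ∧ p ≠ v ∧ q ≠ v ∧ (f p = i ∨ f p = f a) ∧ (f q = i ∨ f q = f a)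
      symm := ⟨fun p q h => ⟨h.1.symm, h.2.2.1, h.2.1, h.2.2.2.2, h.2.2.2.1⟩⟩
      loopless := ⟨fun p h => h.1.ne rfl⟩ }
  have hex : ∃ x, G.Adj v x ∧ f x = i ∧ H.Reachable a x := by
    by_contra hcon
    push Not at hcon
    let g : V → Fin n := fun p => if p = v then f a else
      if H.Reachable a p then (if f p = i then f a else i) else f p
    have hcol : ∀ p, H.Reachable a p → f p = i ∨ f p = f a := by
      intro p hp
      by_cases hpa : p = a
      · right; rw [hpa]
      obtain ⟨w⟩ := hp.symm
      cases w with
      | nil => exact absurd rfl hpa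
      | cons h _ => exact h.2.2.2.1
    have hvn : ∀ q, G.Adj v q → g q ≠ f a := by
      intro q hq
      have hqv : q ≠ v := hq.ne'
      simp only [g, if_neg hqv]
      split_ifs with h1 h2
      · exact absurd h1 (hcon q hq h2)
      · exact hi
      · intro h3
        rw [ha q hq h3] at h1
        exact h1 (SimpleGraph.Reachable.refl _)
    apply hnot g
    have hstep : ∀ p q, p ≠ v → q ≠ v → G.Adj p q → H.Reachable a p → ¬ H.Reachable a q →
        g p ≠ g q := by
      intro p q hp hq hpq h1 h2
      have hfq : ¬ (f q = i ∨ f q = f a) := by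
        intro h3
        exact h2 (h1.trans (SimpleGraph.Adj.reachable ⟨hpq, hp, hq, hcol p h1, h3⟩))
      push Not at hfq
      simp only [g, if_neg hp, if_neg hq, if_pos h1, if_neg h2]
      split_ifs
      · exact hfq.2.symm
      · exact hfq.1.symm
    intro p q hpq
    by_cases hp : p = v
    · subst hp
      have : g p = f a := by simp [g]
      rw [this]
      exact (hvn q hpq).symm
    by_cases hq : q = v
    · subst hq
      have : g q = f a := by simp [g]
      rw [this]
      exact (hvn p hpq.symm)
    by_cases h1 : H.Reachable a p <;> by_cases h2 : H.Reachable a q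
    · have h3 := hf p q hp hq hpq
      have h4 := hcol p h1
      have h5 := hcol q h2
      simp only [g, if_neg hp, if_neg hq, if_pos h1, if_pos h2]
      grind
    · exact hstep p q hp hq hpq h1 h2
    · exact (hstep q p hq hp hpq.symm h2 h1).symm
    · simp only [g, if_neg hp, if_neg hq, if_neg h1, if_neg h2]
      exact hf p q hp hq hpq
  -- minimal distance
  have hex2 : ∃ m, ∃ x, G.Adj v x ∧ f x = i ∧ H.Reachable a x ∧ H.dist a x = m := by
    obtain ⟨x, h1, h2, h3⟩ := hex
    exact ⟨_, x, h1, h2, h3, rfl⟩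
  obtain ⟨x, hvx, hfx, hax, hdx⟩ := Nat.find_spec hex2
  have hmin : ∀ y, G.Adj v y → f y = i → H.Reachable a y → H.dist a x ≤ H.dist a y := by
    intro y h1 h2 h3
    rw [hdx]
    exact Nat.find_min' hex2 ⟨y, h1, h2, h3, rfl⟩
  obtain ⟨p, hp⟩ := hax.exists_walk_length_eq_dist
  clear hdx
  set m := p.length with hm
  have hadj : ∀ t, t < m → H.Adj (p.getVert t) (p.getVert (t+1)) := fun t ht => p.adj_getVert_succ ht
  have h0 : p.getVert 0 = a := p.getVert_zero
  have hme : p.getVert m = x := p.getVert_length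
  have hreach : ∀ t, H.Reachable a (p.getVert t) := fun t => ⟨p.take t⟩
  have hd1 : ∀ t, t ≤ m → H.dist a (p.getVert t) ≤ t := by
    intro t ht
    have := SimpleGraph.dist_le (p.take t)
    rw [SimpleGraph.Walk.take_length] at this
    omega
  have hd2 : ∀ t, t ≤ m → m ≤ H.dist a (p.getVert t) + (m - t) := by
    intro t ht
    obtain ⟨q, hq⟩ := (hreach t).exists_walk_length_eq_dist
    have := SimpleGraph.dist_le (q.append (p.drop t))
    rw [SimpleGraph.Walk.length_append, SimpleGraph.Walk.drop_length] at this
    omega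
  have hd : ∀ t, t ≤ m → H.dist a (p.getVert t) = t := by
    intro t ht
    have := hd1 t ht
    have := hd2 t ht
    omega
  have hmpos : 0 < m := by
    rcases Nat.eq_zero_or_pos m with h | h
    · rw [h, h0] at hme
      rw [hme, hfx] at hi
      exact absurd rfl hi
    · exact h
  have hnv : ∀ t, t ≤ m → p.getVert t ≠ v := by
    intro t ht
    rcases Nat.lt_or_ge t m with h | h
    · exact (hadj t h).2.1
    · have : t = m := by omega
      rw [this, hme]
      exact hvx.ne'
  have hcol : ∀ t, t ≤ m → f (p.getVert t) = if Even t then f a else i := by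
    intro t
    induction t with
    | zero => intro _; simp [h0]
    | succ t ih =>
      intro ht
      have h1 := ih (by omega)
      have h2 := hadj t (by omega)
      have h3 := hf _ _ h2.2.1 h2.2.2.1 h2.1
      have h4 := h2.2.2.2.2
      rw [h1] at h3
      by_cases he : Even t <;> simp [he, Nat.even_add_one] at h3 ⊢ <;> grind
  have hmodd : ¬ Even m := by
    intro he
    have := hcol m le_rfl
    rw [hme, hfx, if_pos he] at this
    exact hi this
  have hHadj : ∀ s t, s ≤ m → t ≤ m → G.Adj (p.getVert s) (p.getVert t) → t ≤ s + 1 := by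
    intro s t hs ht h
    have hc : ∀ t, t ≤ m → f (p.getVert t) = i ∨ f (p.getVert t) = f a := by
      intro t ht
      rw [hcol t ht]
      split_ifs <;> simp
    have hH : H.Adj (p.getVert s) (p.getVert t) := ⟨h, hnv s hs, hnv t ht, hc s hs, hc t ht⟩
    obtain ⟨q, hq⟩ := (hreach s).exists_walk_length_eq_dist
    have := SimpleGraph.dist_le (q.concat hH)
    rw [SimpleGraph.Walk.length_concat, hq, hd s hs, hd t ht] at this
    exact this
  have hvadj : ∀ t, t ≤ m → G.Adj v (p.getVert t) → t = 0 ∨ t = m := by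
    intro t ht h
    have hc := hcol t ht
    split_ifs at hc with he
    · left
      have := ha _ h hc
      have h2 := hd t ht
      rw [this, SimpleGraph.dist_self] at h2
      exact h2.symm
    · right
      have := hmin _ h hc (hreach t)
      rw [hd t ht] at this
      omega
  have hinj : ∀ s t, s ≤ m → t ≤ m → p.getVert s = p.getVert t → s = t := by
    intro s t hs ht h
    rw [← hd s hs, ← hd t ht, h]
  by_cases hm1 : m = 1
  · refine ⟨x, hvx, hfx, ?_⟩
    have := hadj 0 (by omega)
    rw [h0] at this
    rw [← hme, hm1]
    exact this.1
  exfalso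
  apply hfree
  have hm3 : 3 ≤ m := by
    rcases Nat.lt_or_ge m 3 with h | h
    · interval_cases m
      · exact absurd rfl hm1
      · exact absurd (by decide) hmodd
    · exact h
  refine ⟨m + 2, ?_, by omega, ?_⟩
  · rw [Nat.not_even_iff_odd] at hmodd
    exact hmodd.add_even (by decide)
  let φ : Fin (m+2) → V := fun k => if k.val = 0 then v else p.getVert (k.val - 1)
  have hφ : Function.Injective φ := by
    intro s t h
    have hs := s.2
    have ht := t.2
    simp only [φ] at h
    apply Fin.ext
    split_ifs at h with h1 h2 h2
    · omega
    · exact absurd h.symm (hnv _ (by omega))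
    · exact absurd h (hnv _ (by omega))
    · have := hinj _ _ (by omega) (by omega) h
      omega
  have hlt : ∀ s t : Fin (m+2), s.val < t.val →
      (G.Adj (φ s) (φ t) ↔ (t.val = s.val + 1 ∨ (s.val = 0 ∧ t.val = m + 1))) := by
    intro s t hst
    have ht := t.2
    simp only [φ, if_neg (show ¬ t.val = 0 by omega)]
    split_ifs with h1
    · constructor
      · intro h
        have := hvadj _ (by omega) h
        omega
      · rintro (h | h)
        · have : t.val - 1 = 0 := by omega
          rw [this, h0]
          exact hva
        · have : t.val - 1 = m := by omega
          rw [this, hme]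
          exact hvx
    · constructor
      · intro h
        have := hHadj _ _ (by omega) (by omega) h
        omega
      · rintro (h | h)
        · have h2 := hadj (s.val - 1) (by omega)
          have h3 : t.val - 1 = s.val - 1 + 1 := by omega
          rw [h3]
          exact h2.1
        · omega
  have hcyc : ∀ s t : Fin (m+2), s.val < t.val →
      ((SimpleGraph.cycleGraph (m+2)).Adj s t ↔ (t.val = s.val + 1 ∨ (s.val = 0 ∧ t.val = m + 1))) := by
    intro s t hst
    have ht := t.2
    rw [SimpleGraph.cycleGraph_adj']
    have e1 : (t - s).val = t.val - s.val := by
      rw [Fin.sub_val_of_le (by exact hst.le)]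
    have e2 : (s - t).val = m + 2 + s.val - t.val := by
      rw [Fin.coe_sub_iff_lt.2 (by exact hst)]
    rw [e1, e2]
    omega
  refine ⟨⟨⟨φ, hφ⟩, ?_⟩⟩
  intro s t
  show G.Adj (φ s) (φ t) ↔ _
  rcases lt_trichotomy s.val t.val with h | h | h
  · rw [hlt s t h, hcyc s t h]
  · have : s = t := Fin.ext h
    subst this
    simp
  · rw [G.adj_comm, (SimpleGraph.cycleGraph (m+2)).adj_comm, hlt t s h, hcyc t s h]

noncomputable def NB {V : Type*} [Fintype V] (G : SimpleGraph V) (v : V) : Finset V := by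
  classical exact univ.filter (fun u => G.Adj v u)

lemma mem_NB {V : Type*} [Fintype V] (G : SimpleGraph V) (v u : V) : u ∈ NB G v ↔ G.Adj v u := by
  simp [NB]

structure Crit {V : Type*} [Fintype V] (G : SimpleGraph V) (n : ℕ) : Prop where
  free : ¬ ∃ n : ℕ, Odd n ∧ 5 ≤ n ∧ Nonempty (SimpleGraph.cycleGraph n ↪g G)
  hnot : ∀ f : V → Fin n, ¬ ∀ a b, G.Adj a b → f a ≠ f b
  hmin : ∀ T : Finset V, T.Nonempty → ∃ f : V → Fin n, POff G f T
  hdeg : ∀ v, (NB G v).card ≤ n + 1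
  cf : ∀ K : Finset V, (∀ a ∈ K, ∀ b ∈ K, a ≠ b → G.Adj a b) → K.card ≤ n
  hn : 8 ≤ n

lemma Crit.loc {V : Type*} [Fintype V] {G : SimpleGraph V} {n : ℕ} (h : Crit G n) (v : V) :
    (NB G v).card = n + 1 ∧ ∃ x y, x ≠ y ∧ G.Adj v x ∧ G.Adj v y ∧ ¬ G.Adj x y ∧
      (∀ z z', G.Adj v z → G.Adj v z' → z ≠ x → z ≠ y → z' ≠ x → z' ≠ y → z ≠ z' → G.Adj z z') ∧
      (∀ z, G.Adj v z → z ≠ x → z ≠ y → G.Adj z x ∨ G.Adj z y) := by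
  classical
  obtain ⟨f, hf⟩ := h.hmin {v} (by simp)
  have hf' : ∀ a b, a ≠ v → b ≠ v → G.Adj a b → f a ≠ f b := by
    intro a b ha hb
    exact hf a b (by simpa using ha) (by simpa using hb)
  have hsurj : ∀ c, ∃ u ∈ NB G v, f u = c := by
    intro c
    by_contra hcon
    push Not at hcon
    apply h.hnot (Function.update f v c)
    intro a b hab
    by_cases ha : a = v
    · subst ha
      have hb : b ≠ a := hab.ne'
      simp only [Function.update_self, Function.update_of_ne hb]
      exact (hcon b ((mem_NB _ _ _).2 hab)).symm
    by_cases hb : b = v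
    · subst hb
      simp only [Function.update_self, Function.update_of_ne ha]
      exact (hcon a ((mem_NB _ _ _).2 hab.symm))
    simp only [Function.update_of_ne ha, Function.update_of_ne hb]
    exact hf' a b ha hb hab
  have himg : (NB G v).image f = univ := by
    ext c
    simpa using hsurj c
  by_cases hinj : Set.InjOn f (NB G v)
  · exfalso
    have hc := card_image_of_injOn hinj
    rw [himg, card_univ, Fintype.card_fin] at hc
    have hv : v ∉ NB G v := by simp [mem_NB]
    have := h.cf (insert v (NB G v)) (by
      have key : ∀ a b, G.Adj v a → G.Adj v b → a ≠ b → G.Adj a b := by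
        intro a b ha hb hab
        obtain ⟨x, h1, h2, h3⟩ := kempe G h.free h.hnot v f hf' a ha
          (fun b hb hba => hinj (by simpa [mem_NB] using hb) (by simpa [mem_NB] using ha) hba)
          (f b) (fun h => hab (hinj (by simpa [mem_NB] using hb) (by simpa [mem_NB] using ha) h).symm)
        have : x = b := hinj (by simpa [mem_NB] using h1) (by simpa [mem_NB] using hb) h2
        rwa [← this]
      intro a ha b hb hab
      rw [mem_insert, mem_NB] at ha hb
      rcases ha with rfl | ha <;> rcases hb with rfl | hb
      · exact absurd rfl hab
      · exact hb
      · exact ha.symm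
      · exact key a b ha hb hab)
    rw [card_insert_of_notMem hv] at this
    omega
  · unfold Set.InjOn at hinj
    push Not at hinj
    obtain ⟨x, hx, y, hy, hxy, hne⟩ := hinj
    rw [mem_coe] at hx hy
    have gen : ∀ x y, x ∈ NB G v → y ∈ NB G v → f x = f y → x ≠ y →
        (NB G v).card = n + 1 ∧ Set.InjOn f ((NB G v).erase x) := by
      intro x y hx hy hxy hne
      have him : ((NB G v).erase x).image f = univ := by
        ext c
        simp only [mem_image, mem_univ, iff_true]
        obtain ⟨u, hu, rfl⟩ := hsurj c
        by_cases hux : u = x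
        · exact ⟨y, mem_erase.2 ⟨hne.symm, hy⟩, by rw [hux, hxy]⟩
        · exact ⟨u, mem_erase.2 ⟨hux, hu⟩, rfl⟩
      have h1 : (((NB G v).erase x).image f).card = n := by rw [him]; simp
      have h2 := card_image_le (s := (NB G v).erase x) (f := f)
      have h3 := card_erase_of_mem hx
      have h4 := h.hdeg v
      refine ⟨by omega, ?_⟩
      apply injOn_of_card_image_eq
      omega
    obtain ⟨hcard, hi1⟩ := gen x y hx hy hxy hne
    obtain ⟨_, hi2⟩ := gen y x hy hx hxy.symm hne.symm
    rw [mem_NB] at hx hy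
    have huniq : ∀ z b, G.Adj v z → z ≠ x → z ≠ y → G.Adj v b → f b = f z → b = z := by
      intro z b hz hzx hzy hb hbz
      by_cases hbx : b = x
      · subst hbx
        exact hi2 (by simp [mem_NB, hb, hne]) (by simp [mem_NB, hz, hzy]) hbz
      · exact hi1 (by simp [mem_NB, hb, hbx]) (by simp [mem_NB, hz, hzx]) hbz
    refine ⟨hcard, x, y, hne, hx, hy, fun hadj => hf' x y hx.ne' hy.ne' hadj hxy, ?_, ?_⟩
    · intro z z' hz hz' h1 h2 h3 h4 hzz
      obtain ⟨w, hw1, hw2, hw3⟩ := kempe G h.free h.hnot v f hf' z hz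
        (fun b hb hbz => huniq z b hz h1 h2 hb hbz) (f z')
        (fun h => hzz (huniq z z' hz h1 h2 hz' h).symm)
      have := huniq z' w hz' h3 h4 hw1 hw2
      rwa [← this]
    · intro z hz h1 h2
      obtain ⟨w, hw1, hw2, hw3⟩ := kempe G h.free h.hnot v f hf' z hz
        (fun b hb hbz => huniq z b hz h1 h2 hb hbz) (f x)
        (fun h => h1 (huniq z x hz h1 h2 hx h).symm)
      by_cases hwx : w = x
      · left; rwa [← hwx]
      · right
        have : w = y := hi1 (by simp [mem_NB, hw1, hwx]) (by simp [mem_NB, hy, hne.symm]) (by rw [hw2, hxy])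
        rwa [← this]

open Classical in
lemma Crit.out {V : Type*} [Fintype V] {G : SimpleGraph V} {n : ℕ} (h : Crit G n)
    (K : Finset V) (v : V) : (NB G v \ K).card + (K.filter (G.Adj v)).card = n + 1 := by
  have h1 := (h.loc v).1
  have h2 := card_sdiff_add_card_inter (NB G v) K
  have : NB G v ∩ K = K.filter (G.Adj v) := by
    ext u
    simp [mem_NB, and_comm]
  rw [this] at h2
  omega

open Classical in
lemma Crit.caseI {V : Type*} [Fintype V] {G : SimpleGraph V} {n : ℕ} (h : Crit G n)
    (K : Finset V) (hK : K.card = n) (e : Fin 3 → V) (he : Function.Injective e)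
    (heK : ∀ i, e i ∉ K) (hout : ∀ u ∈ K, ∀ p, p ∉ K → G.Adj u p → ∃ i, p = e i)
    (huni : ∀ u ∈ K, ∀ i j, ¬ G.Adj u (e i) → ¬ G.Adj u (e j) → i = j)
    (hwit : ∀ i, ∃ u ∈ K, ¬ G.Adj u (e i)) : False := by
  have hn := h.hn
  let E : Finset V := univ.image e
  obtain ⟨f, hf⟩ := h.hmin (K ∪ E) ⟨e 0, by simp [E]⟩
  let B : Fin 3 → Finset V := fun i => K.filter (fun u => ¬ G.Adj u (e i))
  have hB1 : ∀ i, 1 ≤ (B i).card := by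
    intro i
    obtain ⟨u, hu, hu2⟩ := hwit i
    exact card_pos.2 ⟨u, by simp [B, hu, hu2]⟩
  have hBdisj : ∀ i j, i ≠ j → Disjoint (B i) (B j) := by
    intro i j hij
    rw [disjoint_left]
    intro u hu hu2
    simp only [B, mem_filter] at hu hu2
    exact hij (huni u hu.1 i j hu.2 hu2.2)
  have hBsum : (B 0).card + (B 1).card + (B 2).card ≤ n := by
    rw [← hK, ← card_union_of_disjoint (hBdisj 0 1 (by decide)),
      ← card_union_of_disjoint (disjoint_union_left.2 ⟨hBdisj 0 2 (by decide), hBdisj 1 2 (by decide)⟩)]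
    apply card_le_card
    intro u hu
    simp only [B, mem_union, mem_filter] at hu
    tauto
  have hNe : ∀ i, (NB G (e i) \ K).card ≤ (B i).card + 1 := by
    intro i
    have h1 := h.out K (e i)
    have h2 := card_filter_add_card_filter_not (s := K) (fun u => G.Adj (e i) u)
    have h3 : K.filter (fun u => ¬ G.Adj (e i) u) = B i := by
      simp only [B, G.adj_comm]
    rw [h3] at h2
    have : (K.filter (G.Adj (e i))).card = (K.filter (fun u => G.Adj (e i) u)).card := rfl
    omega
  obtain ⟨f1, hf1, -, hf1i⟩ := ext_hall G f (K ∪ E) E hf (by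
    intro S hS hSn D hD
    have hDb : ∀ i, e i ∈ S → D.card ≤ (B i).card + 1 := by
      intro i hi
      refine le_trans (card_le_card (t := (NB G (e i) \ K).image f) ?_) (card_image_le.trans (hNe i))
      intro d hd
      obtain ⟨p, hp1, hp2, hp3⟩ := hD _ hi d hd
      rw [mem_image]
      refine ⟨p, ?_, hp3⟩
      rw [mem_sdiff, mem_NB]
      exact ⟨hp2, fun hh => hp1 (mem_union_left _ hh)⟩
    let S' : Finset (Fin 3) := univ.filter (fun i => e i ∈ S)
    have hS' : S = S'.image e := by
      ext u
      simp only [S', mem_image, mem_filter, mem_univ, true_and]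
      constructor
      · intro hu
        have := hS hu
        simp only [E, mem_image, mem_univ, true_and] at this
        obtain ⟨i, rfl⟩ := this
        exact ⟨i, hu, rfl⟩
      · rintro ⟨i, hi, rfl⟩
        exact hi
    have hc : S.card = S'.card := by rw [hS', card_image_of_injective _ he]
    have hpos : 0 < S.card := hSn.card_pos
    have hSc : ∀ S : Finset (Fin 3), S.card = (if 0 ∈ S then 1 else 0) + (if 1 ∈ S then 1 else 0)
      + (if 2 ∈ S then 1 else 0) := by decide
    have hSc := hSc S'
    have hb : ∀ i ∈ S', D.card ≤ (B i).card + 1 := by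
      intro i hi
      exact hDb i (by simpa [S'] using hi)
    have b0 := hb 0
    have b1 := hb 1
    have b2 := hb 2
    have c0 := hB1 0
    have c1 := hB1 1
    have c2 := hB1 2
    by_cases m0 : (0 : Fin 3) ∈ S' <;> by_cases m1 : (1 : Fin 3) ∈ S' <;>
      by_cases m2 : (2 : Fin 3) ∈ S' <;>
      simp only [m0, m1, m2, if_true, if_false, true_imp_iff] at hSc b0 b1 b2 <;> omega)
  have hT : (K ∪ E) \ E = K := by
    ext u
    simp only [mem_sdiff, mem_union, E, mem_image, mem_univ, true_and]
    constructor
    · tauto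
    · intro hu
      refine ⟨Or.inl hu, ?_⟩
      rintro ⟨i, rfl⟩
      exact heK i hu
  rw [hT] at hf1
  obtain ⟨f2, hf2, -, -⟩ := ext_hall G f1 K K hf1 (by
    intro S hS hSn D hD
    have hd : ∀ d : D, ∃ i, f1 (e i) = d ∧ ∀ u ∈ S, G.Adj u (e i) := by
      rintro ⟨d, hd⟩
      obtain ⟨u, hu⟩ := hSn
      obtain ⟨p, hp1, hp2, hp3⟩ := hD u hu d hd
      obtain ⟨i, rfl⟩ := hout u (hS hu) p hp1 hp2
      refine ⟨i, hp3, ?_⟩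
      intro u' hu'
      obtain ⟨p', hp1', hp2', hp3'⟩ := hD u' hu' d hd
      obtain ⟨j, rfl⟩ := hout u' (hS hu') p' hp1' hp2'
      have := hf1i (e j) (by simp [E]) (e i) (by simp [E]) (by rw [hp3', hp3])
      rwa [← this]
    choose i hi1 hi2 using hd
    choose w hw1 hw2 using hwit
    have hle : Fintype.card D ≤ (K \ S).card := by
      rw [← card_univ]
      apply card_le_card_of_injOn (fun d => w (i d))
      · intro d _
        simp only [coe_sdiff, Set.mem_sdiff, mem_coe]
        exact ⟨hw1 _, fun hh => hw2 _ (hi2 d _ hh)⟩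
      · intro d _ d' _ hdd
        simp only at hdd
        have h1 := hw2 (i d')
        rw [← hdd] at h1
        have := huni _ (hw1 (i d)) _ _ (hw2 (i d)) h1
        apply Subtype.ext
        rw [← hi1 d, ← hi1 d', this]
    rw [Fintype.card_coe, card_sdiff_of_subset hS] at hle
    have := card_le_card hS
    omega)
  exact h.hnot f2 (fun a b hab => hf2 a b (by simp) (by simp) hab)

lemma exists_color {n : ℕ} (D : Finset (Fin n)) (h : D.card < n) : ∃ c, c ∉ D := by
  by_contra hcon
  push Not at hcon
  have : D = univ := by
    ext c
    simp [hcon c]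
  rw [this] at h
  simp at h

lemma Crit.caseII {V : Type*} [Fintype V] {G : SimpleGraph V} {n : ℕ} (h : Crit G n)
    (K : Finset V) (hK : K.card = n) (hKc : ∀ a ∈ K, ∀ b ∈ K, a ≠ b → G.Adj a b)
    (x u : V) (hx : x ∉ K) (hu : u ∈ K) (hxu : ¬ G.Adj x u)
    (hxK : ∀ c ∈ K, c ≠ u → G.Adj x c) : False := by
  classical
  have hn := h.hn
  set C := K.erase u with hC
  set Q := insert x K with hQ
  have hCc : C.card = n - 1 := by rw [hC, card_erase_of_mem hu, hK]
  have hQc : Q.card = n + 1 := by rw [hQ, card_insert_of_notMem hx, hK]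
  have hxune : x ≠ u := fun hh => hx (hh ▸ hu)
  have memC : ∀ c, c ∈ C ↔ c ≠ u ∧ c ∈ K := fun c => by rw [hC, mem_erase]
  have memQ : ∀ c, c ∈ Q ↔ c = x ∨ c ∈ K := fun c => by rw [hQ, mem_insert]
  have hCQ : ∀ c, c ∉ C → c = x ∨ c = u ∨ c ∉ Q := by
    intro c hc
    rw [memC] at hc
    rw [memQ]
    tauto
  have hCx : ∀ c ∈ C, G.Adj c x := fun c hc => (hxK c ((memC c).1 hc).2 ((memC c).1 hc).1).symm
  have hCu : ∀ c ∈ C, G.Adj c u := fun c hc => hKc c ((memC c).1 hc).2 u hu ((memC c).1 hc).1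
  have hCC : ∀ c ∈ C, ∀ c' ∈ C, c ≠ c' → G.Adj c c' :=
    fun c hc c' hc' => hKc c ((memC c).1 hc).2 c' ((memC c').1 hc').2
  have ho1 : ∀ c ∈ C, (NB G c \ Q).card = 1 := by
    intro c hc
    have h1 := h.out Q c
    have h2 : Q.filter (G.Adj c) = Q.erase c := by
      ext b
      simp only [mem_filter, mem_erase]
      constructor
      · rintro ⟨hb, hb2⟩
        exact ⟨hb2.ne', hb⟩
      · rintro ⟨hb, hb2⟩
        refine ⟨hb2, ?_⟩
        rcases (memQ b).1 hb2 with rfl | hb3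
        · exact hCx c hc
        · exact hKc c ((memC c).1 hc).2 b hb3 hb.symm
    have hcQ : c ∈ Q := (memQ c).2 (Or.inr ((memC c).1 hc).2)
    rw [h2, card_erase_of_mem hcQ, hQc] at h1
    omega
  have hx2 : (NB G x \ Q).card = 2 := by
    have h1 := h.out Q x
    have h2 : Q.filter (G.Adj x) = C := by
      ext b
      rw [mem_filter]
      constructor
      · rintro ⟨hb, hb2⟩
        rw [memC]
        refine ⟨fun hh => hxu (hh ▸ hb2), ?_⟩
        rcases (memQ b).1 hb with rfl | hb3
        · exact absurd rfl hb2.ne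
        · exact hb3
      · intro hb
        exact ⟨(memQ b).2 (Or.inr ((memC b).1 hb).2), (hCx b hb).symm⟩
    rw [h2, hCc] at h1
    omega
  have hu2 : (NB G u \ Q).card = 2 := by
    have h1 := h.out Q u
    have h2 : Q.filter (G.Adj u) = C := by
      ext b
      rw [mem_filter]
      constructor
      · rintro ⟨hb, hb2⟩
        rw [memC]
        refine ⟨hb2.ne', ?_⟩
        rcases (memQ b).1 hb with rfl | hb3
        · exact absurd hb2.symm hxu
        · exact hb3
      · intro hb
        exact ⟨(memQ b).2 (Or.inr ((memC b).1 hb).2), (hCu b hb).symm⟩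
    rw [h2, hCc] at h1
    omega
  have hoex : ∀ c, ∃ o, c ∈ C → NB G c \ Q = {o} := by
    intro c
    by_cases hc : c ∈ C
    · obtain ⟨o, ho⟩ := card_eq_one.1 (ho1 c hc)
      exact ⟨o, fun _ => ho⟩
    · exact ⟨c, fun hh => absurd hh hc⟩
  choose o ho using hoex
  have hoadj : ∀ c ∈ C, G.Adj c (o c) := by
    intro c hc
    have : o c ∈ NB G c \ Q := by rw [ho c hc]; simp
    rw [mem_sdiff, mem_NB] at this
    exact this.1
  have hoQ : ∀ c ∈ C, o c ∉ Q := by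
    intro c hc
    have : o c ∈ NB G c \ Q := by rw [ho c hc]; simp
    rw [mem_sdiff, mem_NB] at this
    exact this.2
  have houniq : ∀ c ∈ C, ∀ p, p ∉ Q → G.Adj c p → p = o c := by
    intro c hc p hp hcp
    have : p ∈ NB G c \ Q := by rw [mem_sdiff, mem_NB]; exact ⟨hcp, hp⟩
    rw [ho c hc] at this
    simpa using this
  have hxQ : x ∈ Q := (memQ x).2 (Or.inl rfl)
  have huQ : u ∈ Q := (memQ u).2 (Or.inr hu)
  have hoxu : ∀ c ∈ C, G.Adj (o c) x ∨ G.Adj (o c) u := by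
    intro c hc
    by_contra hcon
    push Not at hcon
    obtain ⟨k1, k2⟩ := hcon
    obtain ⟨-, p, q, hpq, hp, hq, hnpq, hcl, hor⟩ := h.loc c
    have e1 : o c ≠ x := fun hh => hoQ c hc (hh ▸ hxQ)
    have e2 : o c ≠ u := fun hh => hoQ c hc (hh ▸ huQ)
    have a1 := hoadj c hc
    have a2 := hCx c hc
    have a3 := hCu c hc
    have k3 : ¬ G.Adj x (o c) := fun hh => k1 hh.symm
    have k4 : ¬ G.Adj u (o c) := fun hh => k2 hh.symm
    have k5 : ¬ G.Adj u x := fun hh => hxu hh.symm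
    have c1 := hcl x u a2 a3
    have c2 := hcl x (o c) a2 a1
    have c3 := hcl u (o c) a3 a1
    have d1 := hor x a2
    have d2 := hor u a3
    have d3 := hor (o c) a1
    clear hcl hor
    grind
  obtain ⟨c1, hc1, c1', hc1', hcne, hceq⟩ : ∃ a ∈ C, ∃ b ∈ C, a ≠ b ∧ o a = o b := by
    apply exists_ne_map_eq_of_card_lt_of_maps_to (t := (NB G x \ Q) ∪ (NB G u \ Q))
    · have := card_union_le (NB G x \ Q) (NB G u \ Q)
      omega
    · intro c hc
      have hc : c ∈ C := hc
      simp only [coe_union, Set.mem_union, mem_coe, mem_sdiff, mem_NB]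
      rcases hoxu c hc with h1 | h1
      · exact Or.inl ⟨h1.symm, hoQ c hc⟩
      · exact Or.inr ⟨h1.symm, hoQ c hc⟩
  have hs : ∃ s, s ∈ Q ∧ s ∉ C ∧ G.Adj (o c1) s ∧ ∀ c ∈ C, G.Adj c s := by
    rcases hoxu c1 hc1 with h1 | h1
    · exact ⟨x, hxQ, fun hh => hx ((memC x).1 hh).2, h1, hCx⟩
    · exact ⟨u, huQ, fun hh => ((memC u).1 hh).1 rfl, h1, hCu⟩
  obtain ⟨s, hsQ, hsC, hos, hsadj⟩ := hs
  have hCsubQ : ∀ c ∈ C, c ∈ Q := fun c hc => (memQ c).2 (Or.inr ((memC c).1 hc).2)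
  obtain ⟨c2, hc2, hc2ne⟩ : ∃ c2 ∈ C, o c2 ≠ o c1 := by
    by_contra hcon
    push Not at hcon
    have hno : o c1 ∉ insert s C := by
      rw [mem_insert]
      rintro (hh | hh)
      · exact hos.ne hh
      · exact hoQ c1 hc1 (hCsubQ _ hh)
    have := h.cf (insert (o c1) (insert s C)) (by
      have A1 : ∀ c ∈ C, G.Adj c (o c1) := fun c hc => by
        rw [← hcon c hc]; exact hoadj c hc
      intro a ha b hb hab
      rw [mem_insert, mem_insert] at ha hb
      rcases ha with rfl | rfl | ha <;> rcases hb with rfl | rfl | hb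
      · exact absurd rfl hab
      · exact hos
      · exact (A1 b hb).symm
      · exact hos.symm
      · exact absurd rfl hab
      · exact (hsadj b hb).symm
      · exact A1 a ha
      · exact hsadj a ha
      · exact hCC a ha b hb hab)
    rw [card_insert_of_notMem hno, card_insert_of_notMem hsC] at this
    omega
  have hodeg : (NB G (o c1) \ Q).card ≤ n - 2 := by
    have h1 := h.out Q (o c1)
    have h2 : ({c1, c1', s} : Finset V) ⊆ Q.filter (G.Adj (o c1)) := by
      intro b hb
      simp only [mem_insert, mem_singleton] at hb
      rw [mem_filter]
      rcases hb with rfl | rfl | rfl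
      · exact ⟨hCsubQ _ hc1, (hoadj _ hc1).symm⟩
      · rw [hceq]
        exact ⟨hCsubQ _ hc1', (hoadj _ hc1').symm⟩
      · exact ⟨hsQ, hos⟩
    have h3 := card_le_card h2
    have h4 : ({c1, c1', s} : Finset V).card = 3 := by
      rw [card_eq_three]
      exact ⟨c1, c1', s, hcne, fun hh => hsC (hh ▸ hc1), fun hh => hsC (hh ▸ hc1'), rfl⟩
    omega
  obtain ⟨f, hf⟩ := h.hmin (insert (o c1) Q) (by simp)
  obtain ⟨γ, hγ⟩ := exists_color (insert (f (o c2)) ((NB G (o c1) \ Q).image f)) (by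
    have h1 := card_insert_le (f (o c2)) ((NB G (o c1) \ Q).image f)
    have h2 := card_image_le (s := NB G (o c1) \ Q) (f := f)
    omega)
  rw [mem_insert, not_or] at hγ
  obtain ⟨hγ1, hγ2⟩ := hγ
  have hγ3 : ∀ p, p ∉ Q → G.Adj (o c1) p → f p ≠ γ := by
    intro p hp hp2 hh
    exact hγ2 (mem_image.2 ⟨p, by rw [mem_sdiff, mem_NB]; exact ⟨hp2, hp⟩, hh⟩)
  set f1 := Function.update f (o c1) γ with hf1d
  have hf1 : POff G f1 Q := by
    intro a b ha hb hab
    by_cases h1 : a = o c1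
    · have h2 : b ≠ o c1 := fun hh => hab.ne (h1.trans hh.symm)
      rw [hf1d, Function.update_of_ne h2, h1, Function.update_self]
      exact (hγ3 b hb (h1 ▸ hab)).symm
    by_cases h2 : b = o c1
    · rw [hf1d, Function.update_of_ne h1, h2, Function.update_self]
      exact (hγ3 a ha (h2 ▸ hab.symm))
    rw [hf1d, Function.update_of_ne h1, Function.update_of_ne h2]
    exact hf a b (by simp [h1, ha]) (by simp [h2, hb]) hab
  have hf1ne : f1 (o c1) ≠ f1 (o c2) := by
    rw [hf1d, Function.update_of_ne hc2ne, Function.update_self]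
    exact hγ1
  clear_value f1
  obtain ⟨α, hα⟩ := exists_color ((NB G x \ Q).image f1 ∪ (NB G u \ Q).image f1) (by
    have h1 := card_union_le ((NB G x \ Q).image f1) ((NB G u \ Q).image f1)
    have h2 := card_image_le (s := NB G x \ Q) (f := f1)
    have h3 := card_image_le (s := NB G u \ Q) (f := f1)
    omega)
  rw [mem_union, not_or] at hα
  have hαx : ∀ p, p ∉ Q → G.Adj x p → f1 p ≠ α := by
    intro p hp hp2 hh
    exact hα.1 (mem_image.2 ⟨p, by rw [mem_sdiff, mem_NB]; exact ⟨hp2, hp⟩, hh⟩)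
  have hαu : ∀ p, p ∉ Q → G.Adj u p → f1 p ≠ α := by
    intro p hp hp2 hh
    exact hα.2 (mem_image.2 ⟨p, by rw [mem_sdiff, mem_NB]; exact ⟨hp2, hp⟩, hh⟩)
  let f2 : V → Fin n := fun p => if p = x ∨ p = u then α else f1 p
  have f2xu : ∀ p, (p = x ∨ p = u) → f2 p = α := fun p hp => if_pos hp
  have f2Q : ∀ p, p ∉ Q → f2 p = f1 p := by
    intro p hp
    apply if_neg
    rintro (rfl | rfl)
    · exact hp hxQ
    · exact hp huQ
  have hf2 : POff G f2 C := by
    have hmix : ∀ a b, (a = x ∨ a = u) → b ∉ Q → G.Adj a b → f1 b ≠ α := by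
      rintro a b (rfl | rfl) hb hab
      · exact hαx b hb hab
      · exact hαu b hb hab
    intro a b ha hb hab
    have ha' : (a = x ∨ a = u) ∨ a ∉ Q := by have := hCQ a ha; tauto
    have hb' : (b = x ∨ b = u) ∨ b ∉ Q := by have := hCQ b hb; tauto
    rcases ha' with ha' | ha' <;> rcases hb' with hb' | hb'
    · exfalso
      rcases ha' with rfl | rfl <;> rcases hb' with rfl | rfl
      · exact hab.ne rfl
      · exact hxu hab
      · exact hxu hab.symm
      · exact hab.ne rfl
    · rw [f2xu a ha', f2Q b hb']
      exact (hmix a b ha' hb' hab).symm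
    · rw [f2xu b hb', f2Q a ha']
      exact hmix b a hb' ha' hab.symm
    · rw [f2Q a ha', f2Q b hb']
      exact hf1 a b ha' hb' hab
  obtain ⟨f3, hf3, -, -⟩ := ext_hall G f2 C C hf2 (by
    intro S hS hSn D hD
    have hD2 : ∀ c ∈ S, ∀ d ∈ D, d = α ∨ d = f1 (o c) := by
      intro c hc d hd
      obtain ⟨p, hp1, hp2, hp3⟩ := hD c hc d hd
      have hp' : (p = x ∨ p = u) ∨ p ∉ Q := by have := hCQ p hp1; tauto
      rcases hp' with hp' | hp'
      · left; rw [← hp3, f2xu p hp']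
      · right
        rw [← hp3, f2Q p hp', houniq c (hS hc) p hp' hp2]
    have hSC := card_le_card hS
    rcases Nat.lt_or_ge 1 D.card with hD1 | hD1
    · obtain ⟨d, hd, hdα⟩ := exists_mem_ne hD1 α
      have hSC2 : S.card < C.card := by
        apply card_lt_card
        refine ⟨hS, ?_⟩
        intro hh
        have r1 := (hD2 c1 (hh hc1) d hd).resolve_left hdα
        have r2 := (hD2 c2 (hh hc2) d hd).resolve_left hdα
        exact hf1ne (r1.symm.trans r2)
      obtain ⟨c, hc⟩ := hSn
      have : D.card ≤ 2 := by
        refine le_trans (card_le_card (t := {α, f1 (o c)}) ?_) card_le_two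
        intro d hd
        have := hD2 c hc d hd
        simpa using this
      omega
    · omega)
  exact h.hnot f3 (fun a b hab => hf3 a b (by simp) (by simp) hab)

lemma Crit.out2 {V : Type*} [Fintype V] {G : SimpleGraph V} {n : ℕ} (h : Crit G n)
    (K : Finset V) (hK : K.card = n) (hKc : ∀ a ∈ K, ∀ b ∈ K, a ≠ b → G.Adj a b)
    (z : V) (hz : z ∈ K) : ∃ D : Finset V, D.card = 2 ∧ ∀ p, p ∈ D ↔ (p ∉ K ∧ G.Adj z p) := by
  classical
  have hn := h.hn
  have h1 := h.out K z
  have h2 : K.filter (G.Adj z) = K.erase z := by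
    ext b
    simp only [mem_filter, mem_erase]
    constructor
    · rintro ⟨hb, hb2⟩
      exact ⟨hb2.ne', hb⟩
    · rintro ⟨hb, hb2⟩
      exact ⟨hb2, hKc z hz b hb2 hb.symm⟩
  rw [h2, card_erase_of_mem hz] at h1
  refine ⟨NB G z \ K, by omega, ?_⟩
  intro p
  rw [mem_sdiff, mem_NB, and_comm]

lemma Crit.split {V : Type*} [Fintype V] {G : SimpleGraph V} {n : ℕ} (h : Crit G n)
    (K : Finset V) (hK : K.card = n) (hKc : ∀ a ∈ K, ∀ b ∈ K, a ≠ b → G.Adj a b)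
    (z : V) (hz : z ∈ K) (s t : V) (hs : s ∉ K) (ht : t ∉ K) (hst : s ≠ t)
    (hzs : G.Adj z s) (hzt : G.Adj z t) (c : V) (hc : c ∈ K) : G.Adj c s ∨ G.Adj c t := by
  classical
  have hall : ∀ p, G.Adj z p → p ∉ K → p = s ∨ p = t := by
    obtain ⟨D, hD, hD2⟩ := h.out2 K hK hKc z hz
    intro p hp hpK
    have h1 : ({s, t} : Finset V) = D := by
      apply eq_of_subset_of_card_le
      · intro a ha
        simp only [mem_insert, mem_singleton] at ha
        rw [hD2]
        rcases ha with rfl | rfl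
        · exact ⟨hs, hzs⟩
        · exact ⟨ht, hzt⟩
      · rw [hD, card_pair hst]
    have : p ∈ D := (hD2 p).2 ⟨hpK, hp⟩
    rw [← h1] at this
    simpa using this
  -- a vertex adjacent to all of `K` but possibly one is impossible
  have hbad : ∀ t r, t ∉ K → r ∈ K → (∀ c ∈ K, c ≠ r → G.Adj t c) → False := by
    intro t r ht hr hadj
    by_cases htr : G.Adj t r
    · have hA : ∀ c ∈ K, G.Adj t c := by
        intro c hc
        by_cases hcr : c = r
        · rw [hcr]; exact htr
        · exact hadj c hc hcr
      have := h.cf (insert t K) (by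
        intro a ha b hb hab
        rw [mem_insert] at ha hb
        rcases ha with rfl | ha <;> rcases hb with rfl | hb
        · exact absurd rfl hab
        · exact hA b hb
        · exact (hA a ha).symm
        · exact hKc a ha b hb hab)
      rw [card_insert_of_notMem ht] at this
      omega
    · exact h.caseII K hK hKc t r ht hr htr hadj
  obtain ⟨-, p, q, hpq, hp, hq, hnpq, hcl, hor⟩ := h.loc z
  have hone : ∀ t r p q, G.Adj z t → t ∉ K → r ∈ K → t ≠ p → t ≠ q → (∀ c ∈ K, c ≠ r → c ≠ p ∧ c ≠ q) →
      (∀ z' z'', G.Adj z z' → G.Adj z z'' → z' ≠ p → z' ≠ q → z'' ≠ p → z'' ≠ q → z' ≠ z'' →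
        G.Adj z' z'') → False := by
    intro t r p q hzt ht hr htp htq hc hcl
    apply hbad t r ht hr
    intro c hc1 hcr
    by_cases hcz : c = z
    · rw [hcz]; exact hzt.symm
    · have := hc c hc1 hcr
      exact hcl t c hzt (hKc z hz c hc1 (Ne.symm hcz)) htp htq this.1 this.2
        (fun hh => ht (hh ▸ hc1))
  have hfin : (p = s ∧ q = t) ∨ (p = t ∧ q = s) := by
    by_cases hpK : p ∈ K <;> by_cases hqK : q ∈ K
    · exact absurd (hKc p hpK q hqK hpq) hnpq
    · exfalso
      have hc : ∀ c ∈ K, c ≠ p → c ≠ p ∧ c ≠ q := fun c hc h1 => ⟨h1, fun hh => hqK (hh ▸ hc)⟩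
      rcases hall q hq hqK with rfl | rfl
      · exact hone t p p q hzt ht hpK (fun hh => ht (hh ▸ hpK)) hst.symm hc hcl
      · exact hone s p p q hzs hs hpK (fun hh => hs (hh ▸ hpK)) hst hc hcl
    · exfalso
      have hc : ∀ c ∈ K, c ≠ q → c ≠ p ∧ c ≠ q := fun c hc h1 => ⟨fun hh => hpK (hh ▸ hc), h1⟩
      rcases hall p hp hpK with rfl | rfl
      · exact hone t q p q hzt ht hqK hst.symm (fun hh => ht (hh ▸ hqK)) hc hcl
      · exact hone s q p q hzs hs hqK hst (fun hh => hs (hh ▸ hqK)) hc hcl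
    · rcases hall p hp hpK with h1 | h1 <;> rcases hall q hq hqK with h2 | h2
      · exact absurd (h1.trans h2.symm) hpq
      · exact Or.inl ⟨h1, h2⟩
      · exact Or.inr ⟨h1, h2⟩
      · exact absurd (h1.trans h2.symm) hpq
  by_cases hcz : c = z
  · left; rw [hcz]; exact hzs
  have hzc := hKc z hz c hc (Ne.symm hcz)
  have hcs : c ≠ s := fun hh => hs (hh ▸ hc)
  have hct : c ≠ t := fun hh => ht (hh ▸ hc)
  rcases hfin with ⟨rfl, rfl⟩ | ⟨rfl, rfl⟩
  · exact hor c hzc hcs hct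
  · exact (hor c hzc hct hcs).symm

lemma Crit.false {V : Type*} [Fintype V] {G : SimpleGraph V} {n : ℕ} (h : Crit G n) : False := by
  classical
  have hn := h.hn
  have hV : Nonempty V := by
    by_contra hV
    rw [not_nonempty_iff] at hV
    exact h.hnot (fun v => isEmptyElim v) (fun v => isEmptyElim v)
  obtain ⟨v⟩ := hV
  obtain ⟨hdeg, x, y, hxy, hvx, hvy, hnxy, hcl, -⟩ := h.loc v
  set K := insert v (((NB G v).erase x).erase y) with hKd
  have memK : ∀ c, c ∈ K ↔ c = v ∨ (c ≠ y ∧ c ≠ x ∧ G.Adj v c) := by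
    intro c
    rw [hKd, mem_insert, mem_erase, mem_erase, mem_NB]
  have hK : K.card = n := by
    rw [hKd, card_insert_of_notMem, card_erase_of_mem, card_erase_of_mem, hdeg]
    · omega
    · rw [mem_NB]; exact hvx
    · rw [mem_erase, mem_NB]; exact ⟨hxy.symm, hvy⟩
    · simp [mem_NB]
  have hKc : ∀ a ∈ K, ∀ b ∈ K, a ≠ b → G.Adj a b := by
    intro a ha b hb hab
    rw [memK] at ha hb
    rcases ha with rfl | ⟨a1, a2, a3⟩ <;> rcases hb with rfl | ⟨b1, b2, b3⟩
    · exact absurd rfl hab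
    · exact b3
    · exact a3.symm
    · exact hcl a b a3 b3 a2 a1 b2 b1 hab
  have hvK : v ∈ K := (memK v).2 (Or.inl rfl)
  have hxK : x ∉ K := by
    rw [memK]
    rintro (hh | hh)
    · exact hvx.ne hh.symm
    · exact hh.2.1 rfl
  have hyK : y ∉ K := by
    rw [memK]
    rintro (hh | hh)
    · exact hvy.ne hh.symm
    · exact hh.1 rfl
  clear_value K
  have hnon : ∀ t, t ∉ K → ∃ u ∈ K, ¬ G.Adj u t := by
    intro t ht
    by_contra hcon
    push Not at hcon
    have := h.cf (insert t K) (by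
      intro a ha b hb hab
      rw [mem_insert] at ha hb
      rcases ha with rfl | ha <;> rcases hb with rfl | hb
      · exact absurd rfl hab
      · exact (hcon b hb).symm
      · exact (hcon a ha)
      · exact hKc a ha b hb hab)
    rw [card_insert_of_notMem ht] at this
    omega
  have three : ∀ c ∈ K, ∀ p q r, p ∉ K → q ∉ K → r ∉ K → G.Adj c p → G.Adj c q → G.Adj c r →
      p ≠ q → p ≠ r → q ≠ r → False := by
    intro c hc p q r hp hq hr h1 h2 h3 h4 h5 h6
    obtain ⟨D, hD, hD2⟩ := h.out2 K hK hKc c hc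
    have hsub : ({p, q, r} : Finset V) ⊆ D := by
      intro a ha
      simp only [mem_insert, mem_singleton] at ha
      rw [hD2]
      rcases ha with rfl | rfl | rfl
      · exact ⟨hp, h1⟩
      · exact ⟨hq, h2⟩
      · exact ⟨hr, h3⟩
    have := card_le_card hsub
    rw [card_eq_three.2 ⟨p, q, r, h4, h5, h6, rfl⟩] at this
    omega
  have s1 := h.split K hK hKc v hvK x y hxK hyK hxy hvx hvy
  obtain ⟨u, huK, hux⟩ := hnon x hxK
  obtain ⟨z, hzK, hzy⟩ := hnon y hyK
  have huy := (s1 u huK).resolve_left hux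
  have hzx := (s1 z hzK).resolve_right hzy
  obtain ⟨w, hwK, hzw, hwx⟩ : ∃ w, w ∉ K ∧ G.Adj z w ∧ w ≠ x := by
    obtain ⟨D, hD, hD2⟩ := h.out2 K hK hKc z hzK
    obtain ⟨w, hw, hwx⟩ := exists_mem_ne (show 1 < D.card by omega) x
    exact ⟨w, ((hD2 w).1 hw).1, ((hD2 w).1 hw).2, hwx⟩
  have s2 := h.split K hK hKc z hzK x w hxK hwK hwx.symm hzx hzw
  have huw := (s2 u huK).resolve_left hux
  have hwy : w ≠ y := fun hh => hzy (hh ▸ hzw)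
  have s3 := h.split K hK hKc u huK y w hyK hwK hwy.symm huy huw
  have hvw : ¬ G.Adj v w := fun hh =>
    three v hvK x y w hxK hyK hwK hvx hvy hh hxy hwx.symm hwy.symm
  apply h.caseI K hK ![x, y, w]
  · intro i j hij
    fin_cases i <;> fin_cases j
    · rfl
    · exact absurd hij hxy
    · exact absurd hij hwx.symm
    · exact absurd hij hxy.symm
    · rfl
    · exact absurd hij hwy.symm
    · exact absurd hij hwx
    · exact absurd hij hwy
    · rfl
  · intro i
    fin_cases i <;> simp [hxK, hyK, hwK]
  · intro c hc p hp hcp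
    by_contra hcon
    push Not at hcon
    have p0 : p ≠ x := hcon 0
    have p1 : p ≠ y := hcon 1
    have p2 : p ≠ w := hcon 2
    have t1 := s1 c hc
    have t2 := s2 c hc
    have t3 := s3 c hc
    by_cases g1 : G.Adj c x
    · rcases t3 with g2 | g2
      · exact three c hc p x y hp hxK hyK hcp g1 g2 p0 p1 hxy
      · exact three c hc p x w hp hxK hwK hcp g1 g2 p0 p2 hwx.symm
    · exact three c hc p y w hp hyK hwK hcp (t1.resolve_left g1) (t2.resolve_left g1) p1 p2 hwy.symm
  · intro c hc i j hi hj
    have t1 := s1 c hc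
    have t2 := s2 c hc
    have t3 := s3 c hc
    fin_cases i <;> fin_cases j <;> simp at hi hj ⊢ <;> tauto
  · intro i
    fin_cases i
    · exact ⟨u, huK, hux⟩
    · exact ⟨z, hzK, hzy⟩
    · exact ⟨v, hvK, hvw⟩

lemma main_col (n : ℕ) (hn : 8 ≤ n) (m : ℕ) : ∀ {V : Type*} [Fintype V] (G : SimpleGraph V),
    Fintype.card V = m →
    (¬ ∃ n : ℕ, Odd n ∧ 5 ≤ n ∧ Nonempty (SimpleGraph.cycleGraph n ↪g G)) →
    (∀ v, (NB G v).card ≤ n + 1) →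
    (∀ K : Finset V, (∀ a ∈ K, ∀ b ∈ K, a ≠ b → G.Adj a b) → K.card ≤ n) →
    ∃ f : V → Fin n, ∀ a b, G.Adj a b → f a ≠ f b := by
  classical
  induction m using Nat.strong_induction_on with
  | _ m ih =>
  intro V _ G hm hfree hdeg hcf
  by_contra hcon
  push Not at hcon
  refine Crit.false (G := G) (n := n) ⟨hfree, ?_, ?_, hdeg, hcf, hn⟩
  · intro f hf
    obtain ⟨a, b, h1, h2⟩ := hcon f
    exact hf a b h1 h2
  · intro T hT
    let ι : {a // a ∉ T} ↪ V := Function.Embedding.subtype _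
    obtain ⟨f, hf⟩ := ih (Fintype.card {a // a ∉ T}) (by
      rw [← hm]
      obtain ⟨t, ht⟩ := hT
      exact Fintype.card_subtype_lt (x := t) (by simpa using ht)) (G.comap ι) rfl
      (by
        rintro ⟨k, h1, h2, ⟨e⟩⟩
        exact hfree ⟨k, h1, h2, ⟨e.trans (SimpleGraph.Embedding.comap ι G)⟩⟩)
      (by
        intro v
        refine le_trans ?_ (hdeg (ι v))
        rw [← card_map ι]
        apply card_le_card
        intro a ha
        rw [mem_map] at ha
        obtain ⟨b, hb, rfl⟩ := ha
        rw [mem_NB] at hb ⊢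
        exact hb)
      (by
        intro K hK
        rw [← card_map ι]
        apply hcf
        intro a ha b hb hab
        rw [mem_map] at ha hb
        obtain ⟨a, ha, rfl⟩ := ha
        obtain ⟨b, hb, rfl⟩ := hb
        exact hK a ha b hb (fun hh => hab (by rw [hh])))
    refine ⟨fun p => if hp : p ∉ T then f ⟨p, hp⟩ else ⟨0, by omega⟩, ?_⟩
    intro a b ha hb hab
    simp only [dif_pos ha, dif_pos hb]
    exact hf _ _ hab

end Aux

/-- If `G` is a finite simple odd-hole-free graph with `Δ(G) ≥ 9`,
then `χ(G) ≤ max (Δ(G) - 1) (ω(G))`. -/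
theorem statement_0 {V : Type*} [Fintype V] (G : SimpleGraph V) [DecidableRel G.Adj]
    (hfree : ¬ G.HasOddHole) (hΔ : 9 ≤ G.maxDegree) :
    G.chromaticNumber ≤ (max (G.maxDegree - 1) G.cliqueNum : ℕ) := by
  obtain ⟨f, hf⟩ := main_col (max (G.maxDegree - 1) G.cliqueNum) (by omega) _ G rfl hfree
    (by
      intro v
      have h1 := G.degree_le_maxDegree v
      have h2 : NB G v = G.neighborFinset v := by
        ext u
        rw [mem_NB, SimpleGraph.mem_neighborFinset]
      rw [h2, SimpleGraph.card_neighborFinset_eq_degree]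
      omega)
    (by
      intro K hK
      have : G.IsClique (K : Set V) := fun a ha b hb hab => hK a ha b hb hab
      have := this.card_le_cliqueNum
      omega)
  exact SimpleGraph.Colorable.chromaticNumber_le ⟨SimpleGraph.Coloring.mk f (fun {a b} h => hf a b h)⟩
end

section
/- Let G be a finite simple graph that is odd-hole-free and has maximum degree Δ(G) ≥ 7. Then the chromatic number of G satisfies χ(G) ≤ max{Δ(G) − 1, ω(G)}, where ω(G) is the clique number of G. -/
namespace BK

/-- `c` is a proper colouring on the set `S`. -/
def PO {V : Type*} {k : ℕ} (G : SimpleGraph V) (S : Set V) (c : V → Fin k) : Prop :=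
  ∀ a ∈ S, ∀ b ∈ S, G.Adj a b → c a ≠ c b

theorem cyc_adj {n : ℕ} (u v : Fin n) (h : u.val < v.val) :
    (SimpleGraph.cycleGraph n).Adj u v ↔ (v.val = u.val + 1 ∨ (u.val = 0 ∧ v.val + 1 = n)) := by
  rw [SimpleGraph.cycleGraph_adj', Fin.sub_def, Fin.sub_def]
  have hv := v.2
  have h1 : (n - v.val + u.val) % n = n - v.val + u.val := Nat.mod_eq_of_lt (by omega)
  have h2 : (n - u.val + v.val) % n = v.val - u.val := by
    have : n - u.val + v.val = (v.val - u.val) + n := by omega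
    rw [this, Nat.add_mod_right, Nat.mod_eq_of_lt (by omega)]
  show (n - v.val + u.val) % n = 1 ∨ (n - u.val + v.val) % n = 1 ↔ _
  rw [h1, h2]
  omega

theorem hole_of_fun {V : Type*} (G : SimpleGraph V) (n : ℕ) (f : ℕ → V) (hn : Odd n)
    (h5 : 5 ≤ n) (hinj : ∀ u v, u < v → v < n → f u ≠ f v)
    (hadj : ∀ u v, u < v → v < n → (G.Adj (f u) (f v) ↔ (v = u + 1 ∨ (u = 0 ∧ v + 1 = n)))) :
    G.HasOddHole := by
  refine ⟨n, hn, h5, ⟨⟨⟨fun t => f t.val, ?_⟩, ?_⟩⟩⟩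
  · intro a b hab
    rcases lt_trichotomy a.val b.val with h | h | h
    · exact absurd hab (hinj _ _ h b.2)
    · exact Fin.ext h
    · exact absurd hab.symm (hinj _ _ h a.2)
  · intro a b
    show G.Adj (f a.val) (f b.val) ↔ _
    rcases lt_trichotomy a.val b.val with h | h | h
    · rw [hadj _ _ h b.2, cyc_adj _ _ h]
    · have : a = b := Fin.ext h
      subst this
      simp
    · rw [SimpleGraph.adj_comm, hadj _ _ h a.2, SimpleGraph.adj_comm, cyc_adj _ _ h]

/-- A sequence of length `m` from `A` to `B` along the relation `R`. -/
def Seq {V : Type*} (R : V → V → Prop) (A B : V → Prop) (m : ℕ) (p : ℕ → V) : Prop :=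
  A (p 0) ∧ B (p m) ∧ ∀ t < m, R (p t) (p (t + 1))

/-- Ear lemma: no path from `A` to `B` -/
theorem ear {V : Type*} {k : ℕ} (G : SimpleGraph V) (hG : ¬ G.HasOddHole) (S : Set V)
    (c : V → Fin k) (hc : PO G S c) (i j : Fin k) (x x' : V)
    (hx : x ∉ S) (hx' : x' ∉ S) (hxx : G.Adj x x')
    (h1 : ∀ a ∈ S, G.Adj x a → c a ≠ j) (h2 : ∀ a ∈ S, G.Adj x' a → c a ≠ j)
    (h3 : ∀ a ∈ S, G.Adj x a → G.Adj x' a → c a ≠ i) :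
    ¬ ∃ m p, Seq (fun a b => G.Adj a b ∧ (a ∈ S ∧ (c a = i ∨ c a = j)) ∧
        (b ∈ S ∧ (c b = i ∨ c b = j)))
      (fun a => a ∈ S ∧ G.Adj x a ∧ c a = i) (fun b => b ∈ S ∧ G.Adj x' b ∧ c b = i) m p := by
  classical
  intro hex
  set R : V → V → Prop := (fun a b => G.Adj a b ∧ (a ∈ S ∧ (c a = i ∨ c a = j)) ∧
        (b ∈ S ∧ (c b = i ∨ c b = j))) with hR
  obtain ⟨p, ⟨hp0, hpm, hp⟩⟩ := Nat.find_spec hex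
  have hmin : ∀ m' < Nat.find hex, ∀ p, ¬ Seq R _ _ m' p := fun m' hm' p hp =>
    Nat.find_min hex hm' ⟨p, hp⟩
  generalize Nat.find hex = m at *
  -- every vertex of the path is in S with colour i or j
  have hT : ∀ t ≤ m, p t ∈ S ∧ (c (p t) = i ∨ c (p t) = j) := by
    intro t ht
    rcases Nat.eq_zero_or_pos t with rfl | h0
    · exact ⟨hp0.1, Or.inl hp0.2.2⟩
    · have := (hp (t-1) (by omega)).2.2
      rwa [Nat.sub_add_cancel h0] at this
  have hij : i ≠ j := fun h => h1 _ hp0.1 hp0.2.1 (h ▸ hp0.2.2)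
  have hcol : ∀ t ≤ m, (c (p t) = i ↔ Even t) := by
    intro t
    induction t with
    | zero => intro _; simp [hp0.2.2]
    | succ t ih =>
      intro ht
      have ha := ih (by omega)
      have hne := hc _ (hT t (by omega)).1 _ (hT (t+1) ht).1 (hp t (by omega)).1
      have hA := (hT t (by omega)).2
      have hB := (hT (t+1) ht).2
      rw [Nat.even_add_one, ← ha]
      grind
  have hmE : Even m := (hcol m le_rfl).1 hpm.2.2
  have hm0 : m ≠ 0 := by
    rintro rfl
    exact h3 _ hp0.1 hp0.2.1 hpm.2.1 hp0.2.2
  -- x only sees p 0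
  have hxo : ∀ t ≤ m, G.Adj x (p t) → t = 0 := by
    intro t ht hadj
    by_contra h0
    have hi : c (p t) = i := (hT t ht).2.resolve_right (h1 _ (hT t ht).1 hadj)
    refine hmin (m - t) (by omega) (fun r => p (r + t)) ⟨?_, ?_, ?_⟩
    · simpa using ⟨(hT t ht).1, hadj, hi⟩
    · simpa [Nat.sub_add_cancel ht] using hpm
    · intro r hr
      have := hp (r + t) (by omega)
      rwa [show r + t + 1 = r + 1 + t by omega] at this
  have hxo' : ∀ t ≤ m, G.Adj x' (p t) → t = m := by
    intro t ht hadj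
    by_contra h0
    have hi : c (p t) = i := (hT t ht).2.resolve_right (h2 _ (hT t ht).1 hadj)
    exact hmin t (by omega) p ⟨hp0, ⟨(hT t ht).1, hadj, hi⟩, fun r hr => hp r (by omega)⟩
  -- shortcut
  have hshort : ∀ s t, s + 1 < t → t ≤ m → ¬ R (p s) (p t) := by
    intro s t hst ht hRR
    refine hmin (m - (t - s - 1)) (by omega)
      (fun r => if r ≤ s then p r else p (r + (t - s - 1))) ⟨?_, ?_, ?_⟩
    · simpa using hp0
    · have : ¬ (m - (t - s - 1) ≤ s) := by omega
      simp only [this, if_false]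
      rw [show m - (t - s - 1) + (t - s - 1) = m by omega]
      exact hpm
    · intro r hr
      rcases lt_trichotomy r s with h | h | h
      · simp only [show r ≤ s by omega, show r + 1 ≤ s by omega, if_true]
        exact hp r (by omega)
      · subst h
        simp only [le_refl, if_true, show ¬ (r + 1 ≤ r) by omega, if_false]
        rw [show r + 1 + (t - r - 1) = t by omega]
        exact hRR
      · simp only [show ¬ r ≤ s by omega, show ¬ (r + 1 ≤ s) by omega, if_false]
        rw [show r + 1 + (t - s - 1) = r + (t - s - 1) + 1 by omega]
        exact hp _ (by omega)
  have hpinj : ∀ s t, s < t → t ≤ m → p s ≠ p t := by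
    intro s t hst ht he
    rcases Nat.lt_or_ge t m with h | h
    · exact hshort s (t+1) (by omega) (by omega) (he ▸ hp t h)
    · have : t = m := by omega
      subst this
      have := hxo' s (by omega) (he ▸ hpm.2.1)
      omega
  apply hG
  have hxp : ∀ t ≤ m, p t ≠ x := fun t ht h => hx (h ▸ (hT t ht).1)
  have hxp' : ∀ t ≤ m, p t ≠ x' := fun t ht h => hx' (h ▸ (hT t ht).1)
  refine hole_of_fun G (m + 3) (fun t => if t ≤ m then p t else if t = m + 1 then x' else x)
    ?_ ?_ ?_ ?_
  · exact hmE.add_odd (by decide)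
  · obtain ⟨r, hr⟩ := hmE
    omega
  · intro u v huv hv
    by_cases hvm : v ≤ m
    · simp only [hvm, show u ≤ m by omega, if_true]
      exact hpinj u v huv hvm
    · rcases (show v = m + 1 ∨ v = m + 2 by omega) with rfl | rfl
      · simp only [show u ≤ m by omega, hvm, if_true, if_false]
        exact hxp' u (by omega)
      · by_cases hum : u ≤ m
        · simp only [hum, hvm, if_true, if_false, show ¬ (m + 2 = m + 1) by omega]
          exact hxp u (by omega)
        · have : u = m + 1 := by omega
          subst this
          simp only [hum, hvm, if_true, if_false, show ¬ (m + 2 = m + 1) by omega]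
          exact hxx.ne'
  · intro u v huv hv
    by_cases hvm : v ≤ m
    · simp only [hvm, show u ≤ m by omega, if_true]
      constructor
      · intro hadj
        by_contra hcon
        exact hshort u v (by omega) hvm ⟨hadj, hT u (by omega), hT v hvm⟩
      · rintro (rfl | h)
        · exact (hp u (by omega)).1
        · omega
    · rcases (show v = m + 1 ∨ v = m + 2 by omega) with rfl | rfl
      · simp only [show u ≤ m by omega, hvm, if_true, if_false]
        constructor
        · intro hadj
          left
          rw [hxo' u (by omega) hadj.symm]
        · rintro (h | h)
          · have : u = m := by omega
            subst this
            exact hpm.2.1.symm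
          · omega
      · by_cases hum : u ≤ m
        · simp only [hum, hvm, if_true, if_false, show ¬ (m + 2 = m + 1) by omega]
          constructor
          · intro hadj
            right
            exact ⟨hxo u (by omega) hadj.symm, by trivial⟩
          · rintro (h | h)
            · omega
            · rw [h.1]
              exact hp0.2.1.symm
        · have : u = m + 1 := by omega
          subst this
          simp only [hum, hvm, if_true, if_false, show ¬ (m + 2 = m + 1) by omega]
          exact ⟨fun _ => Or.inl (by trivial), fun _ => hxx.symm⟩

/-- Kempe swap lemma -/
theorem kempe {V : Type*} {k : ℕ} (G : SimpleGraph V) (hG : ¬ G.HasOddHole) (S : Set V)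
    (c : V → Fin k) (hc : PO G S c) (i j : Fin k) (x : V) (X : Set V) (hx : x ∉ S)
    (h1 : ∀ a ∈ S, G.Adj x a → c a ≠ j)
    (hX : ∀ x' ∈ X, x' ∉ S ∧ G.Adj x x' ∧ (∀ a ∈ S, G.Adj x' a → c a ≠ j) ∧
      (∀ a ∈ S, G.Adj x a → G.Adj x' a → c a ≠ i)) :
    ∃ c' : V → Fin k, PO G S c' ∧ (∀ a ∈ S, G.Adj x a → c a = i → c' a = j) ∧
      (∀ x' ∈ X, ∀ b ∈ S, G.Adj x' b → c b = i → c' b = i) ∧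
      (∀ y, c y ≠ i → c y ≠ j → c' y = c y) ∧
      (∀ y, c y = i ∨ c y = j → c' y = i ∨ c' y = j) := by
  classical
  set R : V → V → Prop := (fun a b => G.Adj a b ∧ (a ∈ S ∧ (c a = i ∨ c a = j)) ∧
        (b ∈ S ∧ (c b = i ∨ c b = j))) with hR
  set C : V → Prop := fun y => ∃ m p, Seq R (fun a => a ∈ S ∧ G.Adj x a ∧ c a = i)
    (fun b => b = y) m p with hC
  have hstep : ∀ a b, C a → R a b → C b := by
    rintro a b ⟨m, p, h0, hm, hp⟩ hab
    refine ⟨m + 1, fun t => if t ≤ m then p t else b, ?_, ?_, ?_⟩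
    · simpa using h0
    · simp
    · intro t ht
      by_cases h : t < m
      · simp only [show t ≤ m by omega, show t + 1 ≤ m by omega, if_true]
        exact hp t h
      · have : t = m := by omega
        subst this
        simp only [le_refl, if_true, show ¬ (t + 1 ≤ t) by omega, if_false]
        rw [hm]
        exact hab
  have hCcol : ∀ a, C a → c a = i ∨ c a = j := by
    rintro a ⟨m, p, h0, hm, hp⟩
    rcases Nat.eq_zero_or_pos m with rfl | h
    · subst hm
      exact Or.inl h0.2.2
    · have := (hp (m-1) (by omega)).2.2.2
      rw [Nat.sub_add_cancel h, hm] at this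
      exact this
  refine ⟨fun y => if C y then Equiv.swap i j (c y) else c y, ?_, ?_, ?_, ?_, ?_⟩
  · intro a ha b hb hab
    have hne := hc a ha b hb hab
    by_cases hCa : C a <;> by_cases hCb : C b <;> simp only [hCa, hCb, if_true, if_false]
    · exact fun h => hne ((Equiv.swap i j).injective h)
    · have h4 := hCcol a hCa
      have h5 : ¬ (c b = i ∨ c b = j) := fun h => hCb (hstep a b hCa ⟨hab, ⟨ha, h4⟩, hb, h⟩)
      rcases h4 with h4 | h4 <;> rw [h4] <;> simp <;> grind
    · have h4 := hCcol b hCb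
      have h5 : ¬ (c a = i ∨ c a = j) :=
        fun h => hCa (hstep b a hCb ⟨hab.symm, ⟨hb, h4⟩, ha, h⟩)
      rcases h4 with h4 | h4 <;> rw [h4] <;> simp <;> grind
    · exact hne
  · intro a ha hxa hca
    have : C a := ⟨0, fun _ => a, ⟨ha, hxa, hca⟩, rfl, by simp⟩
    simp [this, hca]
  · intro x' hx' b hb hxb hcb
    have : ¬ C b := by
      rintro ⟨m, p, h0, hm, hp⟩
      obtain ⟨h6, h7, h8, h9⟩ := hX x' hx'
      refine ear G hG S c hc i j x x' hx h6 h7 h1 h8 h9 ⟨m, p, h0, ?_, hp⟩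
      rw [hm]
      exact ⟨hb, hxb, hcb⟩
    simp [this, hcb]
  · intro y hy1 hy2
    by_cases hy : C y
    · simp only [hy, if_true]
      exact Equiv.swap_apply_of_ne_of_ne hy1 hy2
    · simp [hy]
  · intro y hy
    by_cases hCy : C y
    · simp only [hCy, if_true]
      rcases hy with h | h <;> simp [h]
    · simpa [hCy] using hy


/-- The data of a minimal counterexample. -/
structure Crit {V : Type*} [Fintype V] [DecidableEq V] (G : SimpleGraph V) [DecidableRel G.Adj]
    (k : ℕ) : Prop where
  hk : 5 ≤ k
  hG : ¬ G.HasOddHole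
  hdeg : ∀ v, G.degree v ≤ k + 1
  hcl : G.CliqueFree (k + 1)
  hmin : ∀ S : Set V, S ≠ Set.univ → ∃ c : V → Fin k, PO G S c
  hnon : ¬ ∃ c : V → Fin k, PO G Set.univ c

section
variable {V : Type*} [Fintype V] [DecidableEq V] {G : SimpleGraph V} [DecidableRel G.Adj] {k : ℕ}

theorem surj (H : Crit G k) (v : V) (c : V → Fin k) (hc : PO G {v}ᶜ c) (i : Fin k) :
    ∃ w, G.Adj v w ∧ c w = i := by
  by_contra hcon
  push Not at hcon
  refine H.hnon ⟨Function.update c v i, ?_⟩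
  intro a _ b _ hab
  by_cases ha : a = v
  · subst ha
    have hb : b ≠ a := hab.ne'
    simp only [Function.update_self, Function.update_of_ne hb]
    exact (hcon b hab).symm
  · by_cases hb : b = v
    · subst hb
      simp only [Function.update_self, Function.update_of_ne ha]
      exact hcon a hab.symm
    · simp only [Function.update_of_ne ha, Function.update_of_ne hb]
      exact hc a ha b hb hab

theorem uniq_adj (H : Crit G k) (v : V) (c : V → Fin k) (hc : PO G {v}ᶜ c) (a b : V)
    (ha : G.Adj v a) (hb : G.Adj v b) (hab : a ≠ b)
    (hua : ∀ w, G.Adj v w → c w = c a → w = a) (hub : ∀ w, G.Adj v w → c w = c b → w = b) :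
    G.Adj a b := by
  by_contra hnadj
  have hcab : c a ≠ c b := fun h => hab (hub a ha h)
  obtain ⟨c', hc', hA, hB, hO, hIJ⟩ := kempe G H.hG ({v, b}ᶜ : Set V) c
    (fun x hx y hy => hc x (by simp at hx ⊢; tauto) y (by simp at hy ⊢; tauto)) (c a) (c b) v {b}
    (by simp)
    (by
      intro w hw hvw hcw
      have := hub w hvw hcw
      subst this
      simp at hw)
    (by
      rintro x' rfl
      refine ⟨by simp, hb, ?_, ?_⟩
      · intro w hw hbw hcw
        simp at hw
        exact hc w (by simp; tauto) x' (by simp; exact hb.ne') hbw.symm hcw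
      · intro w hw hvw hbw hcw
        have := hua w hvw hcw
        subst this
        exact hnadj hbw.symm)
  have key : ∀ w, w ≠ v → w ≠ b → G.Adj b w → c' w ≠ c b := by
    intro w h1 h2 h3
    have hne : c w ≠ c b := hc w (by simpa using h1) b (by simpa using hb.ne') h3.symm
    by_cases h4 : c w = c a
    · rw [hB b rfl w (by simp; tauto) h3 h4]
      exact hcab
    · rw [hO w h4 hne]
      exact hne
  have key2 : ∀ w, w ≠ b → G.Adj v w → c' w ≠ c a := by
    intro w h2 h3
    by_cases h4 : c w = c a
    · rw [hA w (by simp; exact ⟨h3.ne', h2⟩) h3 h4]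
      exact hcab.symm
    · have h5 : c w ≠ c b := fun h => h2 (hub w h3 h)
      rw [hO w h4 h5]
      exact h4
  refine H.hnon ⟨fun w => if w = v then c a else if w = b then c b else c' w, ?_⟩
  have hbv : b ≠ v := hb.ne'
  intro p _ q _ hpq
  have hpq' := hc' p
  have hne := hpq.ne
  have hs := hpq.symm
  have e1 := key p
  have e2 := key q
  have e3 := key2 p
  have e4 := key2 q
  have e5 := hc' p
  simp only [Set.mem_compl_iff, Set.mem_insert_iff, Set.mem_singleton_iff] at e5
  specialize e5 
  by_cases hpv : p = v
  · subst hpv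
    have hqp : q ≠ p := hne.symm
    by_cases hqb : q = b
    · subst hqb
      simp [hqp]; exact hcab
    · simp [hqp, hqb]
      exact (e4 hqb hpq).symm
  · by_cases hqv : q = v
    · subst hqv
      by_cases hpb : p = b
      · subst hpb
        simp [hpv]; exact hcab.symm
      · simp [hpv, hpb]
        exact e3 hpb hs
    · by_cases hpb : p = b
      · subst hpb
        simp [hpv, hqv, hne.symm]
        exact (e2 hqv hne.symm hpq).symm
      · by_cases hqb : q = b
        · subst hqb
          simp [hpv, hqv, hpb]
          exact e1 hpv hpb hs
        · simp only [hpv, hqv, hpb, hqb, if_false]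
          exact hc' p (by simp; tauto) q (by simp; tauto) hpq

theorem exists_pair (H : Crit G k) (v : V) (c : V → Fin k) (hc : PO G {v}ᶜ c) :
    ∃ w w', w ≠ w' ∧ G.Adj v w ∧ G.Adj v w' ∧ c w = c w' := by
  by_contra hcon
  push Not at hcon
  have hu : ∀ a, G.Adj v a → ∀ w, G.Adj v w → c w = c a → w = a := by
    intro a ha w hw h
    by_contra hne
    exact hcon w a hne hw ha h
  have himg : (G.neighborFinset v).image c = Finset.univ := by
    ext i
    simp only [Finset.mem_image, SimpleGraph.mem_neighborFinset, Finset.mem_univ, iff_true]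
    exact surj H v c hc i
  have hcard : (G.neighborFinset v).card = k := by
    have := Finset.card_image_of_injOn (f := c) (s := G.neighborFinset v) (by
      intro a ha b hb h
      simp at ha hb
      exact hu b hb a ha h)
    rw [himg] at this
    simpa using this.symm
  refine H.hcl (insert v (G.neighborFinset v)) ?_
  rw [SimpleGraph.isNClique_iff]
  refine ⟨?_, ?_⟩
  · intro a ha b hb hab
    simp at ha hb
    rcases ha with rfl | ha
    · rcases hb with rfl | hb
      · exact absurd rfl hab
      · exact hb
    · rcases hb with rfl | hb
      · exact ha.symm
      · exact uniq_adj H v c hc a b ha hb hab (hu a ha) (hu b hb)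
  · rw [Finset.card_insert_of_notMem (by simp), hcard]

theorem deg_ge (H : Crit G k) (v : V) : G.degree v = k + 1 := by
  obtain ⟨c, hc⟩ := H.hmin {v}ᶜ (by intro h; simpa using (Set.ext_iff.1 h v))
  obtain ⟨w, w', hne, hw, hw', hcw⟩ := exists_pair H v c hc
  refine le_antisymm (H.hdeg v) ?_
  have himg : ((G.neighborFinset v).erase w').image c = Finset.univ := by
    ext i
    simp only [Finset.mem_image, Finset.mem_univ, iff_true]
    obtain ⟨z, hz, hi⟩ := surj H v c hc i
    by_cases h : z = w'
    · exact ⟨w, by simp [hne, hw], by rw [hcw, ← h, hi]⟩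
    · exact ⟨z, by simp [h, hz], hi⟩
  have h1 : k ≤ ((G.neighborFinset v).erase w').card := by
    have := Finset.card_image_le (s := (G.neighborFinset v).erase w') (f := c)
    rw [himg] at this
    simpa using this
  rw [Finset.card_erase_of_mem (by simpa using hw'), SimpleGraph.card_neighborFinset_eq_degree] at h1
  have := H.hk
  omega

theorem uniq_of_pair (H : Crit G k) (v : V) (c : V → Fin k) (hc : PO G {v}ᶜ c) (w w' : V)
    (hne : w ≠ w') (hw : G.Adj v w) (hw' : G.Adj v w') (hcw : c w = c w') (q : V)
    (hq : G.Adj v q) (hqw : q ≠ w) (hqw' : q ≠ w') (q' : V) (hq' : G.Adj v q')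
    (hcq : c q' = c q) : q' = q := by
  by_contra hqq
  have himg : (((G.neighborFinset v).erase w').erase q).image c = Finset.univ := by
    ext i
    simp only [Finset.mem_image, Finset.mem_univ, iff_true]
    obtain ⟨z, hz, hi⟩ := surj H v c hc i
    simp only [Finset.mem_erase, SimpleGraph.mem_neighborFinset]
    by_cases h : z = w'
    · exact ⟨w, ⟨hqw.symm, hne, hw⟩, by rw [hcw, ← h, hi]⟩
    · by_cases h2 : z = q
      · by_cases h3 : q' = w'
        · exact ⟨w, ⟨hqw.symm, hne, hw⟩, by rw [hcw, ← h3, hcq, ← h2, hi]⟩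
        · exact ⟨q', ⟨hqq, h3, hq'⟩, by rw [hcq, ← h2, hi]⟩
      · exact ⟨z, ⟨h2, h, hz⟩, hi⟩
  have h1 : k ≤ (((G.neighborFinset v).erase w').erase q).card := by
    have := Finset.card_image_le (s := ((G.neighborFinset v).erase w').erase q) (f := c)
    rw [himg] at this
    simpa using this
  rw [Finset.card_erase_of_mem (by simp [hq, hqw']), Finset.card_erase_of_mem (by simpa using hw'),
    SimpleGraph.card_neighborFinset_eq_degree] at h1
  have := H.hk
  have := H.hdeg v
  omega

/-- Structure around a vertex. -/
theorem struct (H : Crit G k) (v : V) : ∃ (c : V → Fin k) (w w' : V), PO G {v}ᶜ c ∧ w ≠ w' ∧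
    G.Adj v w ∧ G.Adj v w' ∧ c w = c w' ∧
    (∀ q, G.Adj v q → q ≠ w → q ≠ w' → ∀ q', G.Adj v q' → c q' = c q → q' = q) ∧
    G.IsNClique k (insert v (((G.neighborFinset v).erase w).erase w')) := by
  obtain ⟨c, hc⟩ := H.hmin {v}ᶜ (by intro h; simpa using (Set.ext_iff.1 h v))
  obtain ⟨w, w', hne, hw, hw', hcw⟩ := exists_pair H v c hc
  have hu := uniq_of_pair H v c hc w w' hne hw hw' hcw
  refine ⟨c, w, w', hc, hne, hw, hw', hcw, hu, ?_⟩
  rw [SimpleGraph.isNClique_iff]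
  refine ⟨?_, ?_⟩
  · intro a ha b hb hab
    simp only [Finset.coe_insert, Set.mem_insert_iff, Finset.mem_coe, Finset.mem_erase,
      SimpleGraph.mem_neighborFinset] at ha hb
    rcases ha with rfl | ha
    · rcases hb with rfl | hb
      · exact absurd rfl hab
      · exact hb.2.2
    · rcases hb with rfl | hb
      · exact ha.2.2.symm
      · exact uniq_adj H v c hc a b ha.2.2 hb.2.2 hab (hu a ha.2.2 ha.2.1 ha.1)
          (hu b hb.2.2 hb.2.1 hb.1)
  · have := H.hk
    rw [Finset.card_insert_of_notMem (by simp), Finset.card_erase_of_mem (by simp [hw', hne.symm]),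
      Finset.card_erase_of_mem (by simpa using hw), SimpleGraph.card_neighborFinset_eq_degree,
      deg_ge H v]
    omega

/-- Hall-type lemma -/
theorem hall (D : Finset V) (hD : D.card + 1 = k) (f : V → Fin k) (p : Fin k)
    (hf : ∃ d ∈ D, ∃ d' ∈ D, f d ≠ f d') :
    ∃ g : V → Fin k, (∀ a ∈ D, ∀ b ∈ D, g a = g b → a = b) ∧ ∀ a ∈ D, g a ≠ p ∧ g a ≠ f a := by
  have hmain : ∃ g : D → Fin k, Function.Injective g ∧
      ∀ x, g x ∈ (Finset.univ.erase p).erase (f x.1) := by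
    rw [← Finset.all_card_le_biUnion_card_iff_exists_injective]
    intro s
    have hDc : Fintype.card D = D.card := by simp
    by_cases hs : ∃ a ∈ s, ∃ b ∈ s, f a.1 ≠ f b.1
    · obtain ⟨a, ha, b, hb, hab⟩ := hs
      have hsub : Finset.univ.erase p ⊆ s.biUnion (fun x => (Finset.univ.erase p).erase (f x.1)) := by
        intro q hq
        simp only [Finset.mem_biUnion, Finset.mem_erase]
        simp only [Finset.mem_erase] at hq
        by_cases h : q = f a.1
        · exact ⟨b, hb, by rw [h]; exact hab, hq⟩
        · exact ⟨a, ha, h, hq⟩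
      have h1 := Finset.card_le_card hsub
      have h2 : s.card ≤ D.card := by rw [← hDc]; exact Finset.card_le_univ s
      simp at h1
      omega
    · push Not at hs
      rcases s.eq_empty_or_nonempty with rfl | ⟨a, ha⟩
      · simp
      · have hsub : (Finset.univ.erase p).erase (f a.1) ⊆
            s.biUnion (fun x => (Finset.univ.erase p).erase (f x.1)) :=
          Finset.subset_biUnion_of_mem (fun x : D => (Finset.univ.erase p).erase (f x.1)) ha
        have h1 := Finset.card_le_card hsub
        have h2 : s.card < D.card := by
          obtain ⟨x, hx⟩ : ∃ x : D, x ∉ s := by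
            obtain ⟨d, hd, d', hd', hne⟩ := hf
            by_cases h : (⟨d, hd⟩ : D) ∈ s
            · exact ⟨⟨d', hd'⟩, fun h' => hne (hs _ h _ h')⟩
            · exact ⟨_, h⟩
          rw [← hDc]
          exact Finset.card_lt_univ_of_notMem hx
        have h3 := Finset.pred_card_le_card_erase (s := Finset.univ.erase p) (a := f a.1)
        simp only [Finset.card_erase_of_mem (Finset.mem_univ p), Finset.card_univ,
          Fintype.card_fin] at h3
        omega
  obtain ⟨g, hg, hg'⟩ := hmain
  have hk : 0 < k := by omega
  refine ⟨fun x => if h : x ∈ D then g ⟨x, h⟩ else ⟨0, hk⟩, ?_, ?_⟩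
  · intro a ha b hb h
    simp only [ha, hb, dif_pos] at h
    simpa using hg h
  · intro a ha
    have := hg' ⟨a, ha⟩
    simp only [Finset.mem_erase] at this
    simp only [ha, dif_pos]
    exact ⟨this.2.1, this.1⟩

theorem not_full (H : Crit G k) (K : Finset V) (hK : G.IsNClique k K) (w : V) (hw : w ∉ K) :
    ∃ y ∈ K, ¬ G.Adj w y := by
  by_contra hcon
  push Not at hcon
  exact H.hcl _ (hK.insert hcon)

theorem case_two (H : Crit G k) (K : Finset V) (hK : G.IsNClique k K) (w : V) (hw : w ∉ K)
    (hcard : k ≤ (K.filter (G.Adj w)).card + 1) : False := by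
  have hk := H.hk
  obtain ⟨y, hy, hwy⟩ := not_full H K hK w hw
  have hKc : K.card = k := hK.card_eq
  have hKadj : ∀ a ∈ K, ∀ b ∈ K, a ≠ b → G.Adj a b := fun a ha b hb h => hK.isClique ha hb h
  obtain ⟨D, hDdef⟩ : ∃ D, D = K.erase y := ⟨_, rfl⟩
  have hDc : D.card + 1 = k := by
    rw [hDdef, Finset.card_erase_of_mem hy]
    omega
  have hDw : ∀ d ∈ D, G.Adj w d := by
    have hsub : K.filter (G.Adj w) ⊆ D := by
      intro a ha
      simp only [Finset.mem_filter] at ha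
      rw [hDdef, Finset.mem_erase]
      exact ⟨fun h => hwy (h ▸ ha.2), ha.1⟩
    have := Finset.eq_of_subset_of_card_le hsub (by omega)
    intro d hd
    rw [← this] at hd
    exact (Finset.mem_filter.1 hd).2
  have hDK : ∀ d, d ∈ D ↔ d ≠ y ∧ d ∈ K := by
    intro d
    rw [hDdef, Finset.mem_erase]
  have hwy' : w ≠ y := fun h => hw (h ▸ hy)
  have hDy : ∀ d ∈ D, G.Adj y d := fun d hd =>
    hKadj y hy d ((hDK d).1 hd).2 ((hDK d).1 hd).1.symm
  have hDD : ∀ d ∈ D, ∀ d' ∈ D, d ≠ d' → G.Adj d d' := fun d hd d' hd' h =>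
    hKadj d ((hDK d).1 hd).2 d' ((hDK d').1 hd').2 h
  have hwD : w ∉ D := fun h => hw ((hDK w).1 h).2
  have hyD : y ∉ D := fun h => ((hDK y).1 h).1 rfl
  obtain ⟨M, hM⟩ : ∃ M, M = insert w (insert y D) := ⟨_, rfl⟩
  have hMmem : ∀ z, z ∈ M ↔ z = w ∨ z = y ∨ z ∈ D := by
    intro z; rw [hM]; simp
  -- outer neighbours
  have hout : ∀ d ∈ D, ∃ u, u ∉ M ∧ G.Adj d u ∧ ∀ z, z ∉ M → G.Adj d z → z = u := by
    intro d hd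
    have hsub : M.erase d ⊆ G.neighborFinset d := by
      intro z hz
      rw [Finset.mem_erase, hMmem] at hz
      rw [SimpleGraph.mem_neighborFinset]
      rcases hz with ⟨h1, rfl | rfl | h2⟩
      · exact (hDw d hd).symm
      · exact (hDy d hd).symm
      · exact hDD d hd z h2 h1.symm
    have hMc : (M.erase d).card = k := by
      rw [Finset.card_erase_of_mem ((hMmem d).2 (Or.inr (Or.inr hd))), hM,
        Finset.card_insert_of_notMem (by simp [hwy', hwD]), Finset.card_insert_of_notMem hyD]
      omega
    have h1 : (G.neighborFinset d \ M.erase d).card = 1 := by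
      rw [Finset.card_sdiff_of_subset hsub, SimpleGraph.card_neighborFinset_eq_degree, deg_ge H d, hMc]
      omega
    obtain ⟨u, hu⟩ := Finset.card_eq_one.1 h1
    have hu' : ∀ z, z = u ↔ (G.Adj d z ∧ z ∉ M) := by
      intro z
      have := Finset.ext_iff.1 hu z
      simp only [Finset.mem_sdiff, SimpleGraph.mem_neighborFinset, Finset.mem_erase,
        Finset.mem_singleton] at this
      rw [← this]
      constructor
      · rintro ⟨h, h'⟩
        exact ⟨h, fun h2 => h' ⟨h.ne', h2⟩⟩
      · rintro ⟨h, h'⟩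
        exact ⟨h, fun h2 => h' h2.2⟩
    exact ⟨u, ((hu' u).1 rfl).2, ((hu' u).1 rfl).1, fun z hz hdz => (hu' z).2 ⟨hdz, hz⟩⟩
  choose! u huM hud huu using hout
  have hout2 : ∀ x, x ∉ D → (∀ d ∈ D, G.Adj x d) → (G.neighborFinset x \ D).card = 2 := by
    intro x hx hxd
    have hsub : D ⊆ G.neighborFinset x := by
      intro z hz
      simpa using hxd z hz
    rw [Finset.card_sdiff_of_subset hsub, SimpleGraph.card_neighborFinset_eq_degree, deg_ge H x]
    omega
  have hW := hout2 w hwD hDw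
  have hY := hout2 y hyD hDy
  -- extension lemma
  have hext : ∀ (c : V → Fin k) (p : Fin k) (g : V → Fin k), PO G {z | z ∉ M} c →
      (∀ z, z ∉ M → G.Adj w z → c z ≠ p) → (∀ z, z ∉ M → G.Adj y z → c z ≠ p) →
      (∀ a ∈ D, ∀ b ∈ D, g a = g b → a = b) →
      (∀ a ∈ D, g a ≠ p ∧ g a ≠ c (u a)) → False := by
    intro c p g hc hpw hpy hginj hg
    refine H.hnon ⟨fun z => if z ∈ D then g z else if z ∈ M then p else c z, ?_⟩
    have hhalf : ∀ a b, G.Adj a b → (b ∈ D → a ∈ D) → (b ∈ M → a ∈ M) → 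
        (fun z => if z ∈ D then g z else if z ∈ M then p else c z) a ≠
        (fun z => if z ∈ D then g z else if z ∈ M then p else c z) b := by
      intro a b hab hbD hbM
      by_cases ha : a ∈ D
      · by_cases hb : b ∈ D
        · simp only [ha, hb, if_true]
          exact fun h => hab.ne (hginj a ha b hb h)
        · by_cases hbM' : b ∈ M
          · simp only [ha, hb, hbM', if_true, if_false]
            exact (hg a ha).1
          · simp only [ha, hb, hbM', if_true, if_false]
            rw [huu a ha b hbM' hab]
            exact (hg a ha).2
      · have hb : b ∉ D := fun h => ha (hbD h)
        by_cases haM : a ∈ M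
        · have ha2 : a = w ∨ a = y := by
            have := (hMmem a).1 haM
            tauto
          by_cases hbM' : b ∈ M
          · exfalso
            have hb2 : b = w ∨ b = y := by
              have := (hMmem b).1 hbM'
              tauto
            have := hab.ne
            have := hab.symm
            rcases ha2 with rfl | rfl <;> rcases hb2 with rfl | rfl <;> tauto
          · simp only [ha, hb, haM, hbM', if_true, if_false]
            rcases ha2 with rfl | rfl
            · exact (hpw b hbM' hab).symm
            · exact (hpy b hbM' hab).symm
        · have hbM' : b ∉ M := fun h => haM (hbM h)
          simp only [ha, hb, haM, hbM', if_false]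
          exact hc a haM b hbM' hab
    have hDM : ∀ z, z ∈ D → z ∈ M := fun z hz => (hMmem z).2 (Or.inr (Or.inr hz))
    intro a _ b _ hab
    by_cases h : (b ∈ D → a ∈ D) ∧ (b ∈ M → a ∈ M)
    · exact hhalf a b hab h.1 h.2
    · have h' : (a ∈ D → b ∈ D) ∧ (a ∈ M → b ∈ M) := by
        have := hDM a
        have := hDM b
        tauto
      exact (hhalf b a hab.symm h'.1 h'.2).symm
  have hMne : ∀ z, z ∉ M → z ∉ D := fun z hz h => hz ((hMmem z).2 (Or.inr (Or.inr h)))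
  obtain ⟨c, hc⟩ := H.hmin {z | z ∉ M} (by
    intro h
    have := Set.ext_iff.1 h w
    simp [hMmem] at this)
  -- bad colours
  have hbad : ∀ c : V → Fin k, ∃ B : Finset (Fin k), B.card ≤ 4 ∧
      (∀ z, z ∉ M → G.Adj w z → c z ∈ B) ∧ (∀ z, z ∉ M → G.Adj y z → c z ∈ B) := by
    intro c
    refine ⟨((G.neighborFinset w \ D) ∪ (G.neighborFinset y \ D)).image c, ?_, ?_, ?_⟩
    · refine Finset.card_image_le.trans ((Finset.card_union_le _ _).trans ?_)
      omega
    · intro z hz hwz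
      refine Finset.mem_image_of_mem c ?_
      simp only [Finset.mem_union, Finset.mem_sdiff, SimpleGraph.mem_neighborFinset]
      exact Or.inl ⟨hwz, hMne z hz⟩
    · intro z hz hwz
      refine Finset.mem_image_of_mem c ?_
      simp only [Finset.mem_union, Finset.mem_sdiff, SimpleGraph.mem_neighborFinset]
      exact Or.inr ⟨hwz, hMne z hz⟩
  have hgood : ∀ B : Finset (Fin k), B.card ≤ 4 → ∃ p, p ∉ B := by
    intro B hB
    by_contra hcon
    push Not at hcon
    have : B = Finset.univ := Finset.eq_univ_iff_forall.2 hcon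
    rw [this] at hB
    simp at hB
    omega
  by_cases hA : ∃ d ∈ D, ∃ d' ∈ D, u d ≠ u d'
  · obtain ⟨d, hd, d', hd', hne⟩ := hA
    have hdd : d ≠ d' := fun h => hne (by rw [h])
    have hdM : ∀ z ∈ D, z ∈ M := fun z hz => (hMmem z).2 (Or.inr (Or.inr hz))
    have : ∃ c : V → Fin k, PO G {z | z ∉ M} c ∧ c (u d) ≠ c (u d') := by
      by_cases heq : c (u d) = c (u d')
      · obtain ⟨j, hj⟩ := hgood {c (u d)} (by simp)
        simp only [Finset.mem_singleton] at hj
        obtain ⟨c', hc', h1, h2, _, _⟩ := kempe G H.hG {z | z ∉ M} c hc (c (u d)) j d {d'}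
          (by simpa using hdM d hd)
          (by
            intro a ha hda
            rw [huu d hd a ha hda]
            exact fun h => hj h.symm)
          (by
            rintro x rfl
            refine ⟨by simpa using hdM x hd', hDD d hd x hd' hdd, ?_, ?_⟩
            · intro a ha hda
              rw [huu x hd' a ha hda, ← heq]
              exact fun h => hj h.symm
            · intro a ha h3 h4
              exact absurd ((huu d hd a ha h3).symm.trans (huu x hd' a ha h4)) hne)
        refine ⟨c', hc', ?_⟩
        rw [h1 _ (huM d hd) (hud d hd) rfl, h2 d' rfl _ (huM d' hd') (hud d' hd') heq.symm]
        exact hj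
      · exact ⟨c, hc, heq⟩
    obtain ⟨c, hc, hcne⟩ := this
    obtain ⟨B, hB, hBw, hBy⟩ := hbad c
    obtain ⟨p, hp⟩ := hgood B hB
    obtain ⟨g, hg1, hg2⟩ := hall D hDc (fun z => c (u z)) p ⟨d, hd, d', hd', hcne⟩
    exact hext c p g hc (fun z hz h e => hp (e ▸ hBw z hz h)) (fun z hz h e => hp (e ▸ hBy z hz h))
      hg1 hg2
  · push Not at hA
    obtain ⟨d, hd⟩ : D.Nonempty := by
      rw [← Finset.card_pos]; omega
    -- a colouring in which the colour of `u` is free at `w` and `y` suffices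
    have hfin : ∀ c : V → Fin k, PO G {z | z ∉ M} c →
        (∀ z, z ∉ M → G.Adj w z → c z ≠ c (u d)) → (∀ z, z ∉ M → G.Adj y z → c z ≠ c (u d)) →
        False := by
      intro c hc h1 h2
      obtain ⟨g, hg⟩ : ∃ g : D → {q : Fin k // q ≠ c (u d)}, Function.Injective g := by
        have : Fintype.card D ≤ Fintype.card {q : Fin k // q ≠ c (u d)} := by
          rw [Fintype.card_subtype_compl]
          simp
          omega
        obtain ⟨e⟩ := Function.Embedding.nonempty_of_card_le this
        exact ⟨e, e.injective⟩
      refine hext c (c (u d)) (fun z => if h : z ∈ D then (g ⟨z, h⟩).1 else c z) hc h1 h2 ?_ ?_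
      · intro a ha b hb h
        simp only [ha, hb, dif_pos] at h
        simpa using hg (Subtype.ext h)
      · intro a ha
        simp only [ha, dif_pos]
        rw [hA a ha d hd]
        exact ⟨(g ⟨a, ha⟩).2, (g ⟨a, ha⟩).2⟩
    have hDcl : ∀ x, x ∉ D → (∀ d ∈ D, G.Adj x d) → G.IsNClique k (insert x D) := by
      intro x _ h2
      have : G.IsNClique (D.card) D :=
        ⟨fun a ha b hb h => hDD a ha b hb h, rfl⟩
      rw [← hDc]
      exact this.insert h2
    have hua : ∀ d' ∈ D, G.Adj (u d) d' := by
      intro d' hd'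
      rw [hA d hd d' hd']
      exact (hud d' hd').symm
    have hux : ∀ x, x ∉ D → (∀ d ∈ D, G.Adj x d) → ¬ G.Adj x (u d) := by
      intro x h1 h2 h3
      refine H.hcl _ ((hDcl x h1 h2).insert (a := u d) ?_)
      intro b hb
      rw [Finset.mem_insert] at hb
      rcases hb with rfl | hb
      · exact h3.symm
      · exact hua b hb
    by_cases hfree : (∀ z, z ∉ M → G.Adj w z → c z ≠ c (u d)) ∧
        (∀ z, z ∉ M → G.Adj y z → c z ≠ c (u d))
    · exact hfin c hc hfree.1 hfree.2
    · obtain ⟨B, hB, hBw, hBy⟩ := hbad c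
      obtain ⟨j, hj⟩ := hgood B hB
      have hiB : c (u d) ∈ B := by
        by_contra h
        exact hfree ⟨fun z hz hwz e => h (e ▸ hBw z hz hwz), fun z hz hwz e => h (e ▸ hBy z hz hwz)⟩
      have hij : c (u d) ≠ j := fun h => hj (h ▸ hiB)
      have hdM : ∀ z ∈ D, z ∈ M := fun z hz => (hMmem z).2 (Or.inr (Or.inr hz))
      obtain ⟨c', hc', h1, h2, h3, _⟩ := kempe G H.hG {z | z ∉ M} c hc (c (u d)) j d {w, y}
          (by simpa using hdM d hd)
          (by
            intro a ha hda
            rw [huu d hd a ha hda]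
            exact hij)
          (by
            rintro x (rfl | rfl)
            · refine ⟨by simp [hMmem], (hDw d hd).symm, ?_, ?_⟩
              · intro a ha hda h
                exact hj (h ▸ hBw a ha hda)
              · intro a ha h3 h4
                rw [huu d hd a ha h3] at h4
                exact absurd h4 (hux x hwD hDw)
            · refine ⟨by simp [hMmem], (hDy d hd).symm, ?_, ?_⟩
              · intro a ha hda h
                exact hj (h ▸ hBy a ha hda)
              · intro a ha h3 h4
                rw [huu d hd a ha h3] at h4
                exact absurd h4 (hux x hyD hDy))
      have hcu : c' (u d) = j := h1 _ (huM d hd) (hud d hd) rfl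
      refine hfin c' hc' ?_ ?_
      · intro z hz hwz
        rw [hcu]
        by_cases h : c z = c (u d)
        · rw [h2 w (by simp) z hz hwz h]
          exact hij
        · have hzj : c z ≠ j := fun h => hj (h ▸ hBw z hz hwz)
          rw [h3 z h hzj]
          exact hzj
      · intro z hz hwz
        rw [hcu]
        by_cases h : c z = c (u d)
        · rw [h2 y (by simp) z hz hwz h]
          exact hij
        · have hzj : c z ≠ j := fun h => hj (h ▸ hBy z hz hwz)
          rw [h3 z h hzj]
          exact hzj

theorem case_one (H : Crit G k)
    (hno : ∀ K : Finset V, G.IsNClique k K → ∀ w, w ∉ K →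
      (K.filter (G.Adj w)).card + 1 < k) (v : V) : False := by
  have hk := H.hk
  obtain ⟨c, w, w', hc, hne, hw, hw', hcw, hu, hK⟩ := struct H v
  obtain ⟨K, hKdef⟩ : ∃ K, K = insert v (((G.neighborFinset v).erase w).erase w') := ⟨_, rfl⟩
  rw [← hKdef] at hK
  have hKmem : ∀ z, z ∈ K ↔ z = v ∨ (z ≠ w' ∧ z ≠ w ∧ G.Adj v z) := by
    intro z; rw [hKdef]; simp
  have hvK : v ∈ K := (hKmem v).2 (Or.inl rfl)
  have hwK : w ∉ K := by
    rw [hKmem]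
    rintro (h | h)
    · exact hw.ne' h
    · exact h.2.1 rfl
  have hwK' : w' ∉ K := by
    rw [hKmem]
    rintro (h | h)
    · exact hw'.ne' h
    · exact h.1 rfl
  have hKadj : ∀ a ∈ K, ∀ b ∈ K, a ≠ b → G.Adj a b := fun a ha b hb h => hK.isClique ha hb h
  have hKu : ∀ x ∈ K, x ≠ v → ∀ q', G.Adj v q' → c q' = c x → q' = x := by
    intro x hx hxv
    have := ((hKmem x).1 hx).resolve_left hxv
    exact hu x this.2.2 this.2.1 this.1
  have hK0 : ∀ x ∈ K, x ≠ v → c x ≠ c w := by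
    intro x hx hxv h
    have := hKu x hx hxv w hw h.symm
    exact hwK (this ▸ hx)
  have hKinj : ∀ x ∈ K, x ≠ v → ∀ y ∈ K, y ≠ v → c y = c x → y = x := by
    intro x hx hxv y hy hyv h
    exact hKu x hx hxv y (hKadj v hvK y hy hyv.symm) h
  -- all outer neighbours of `K` have colour `c w`
  have hout : ∀ x ∈ K, ∀ z, z ∉ K → G.Adj x z → c z = c w := by
    intro x hx z hz hxz
    by_cases hxv : x = v
    · subst hxv
      rw [hKmem] at hz
      push Not at hz
      by_cases h1 : z = w'
      · rw [h1, hcw]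
      · by_cases h2 : z = w
        · rw [h2]
        · exact absurd hxz (hz.2 h1 h2)
    · by_contra hzc
      have hzv : z ≠ v := fun h => hz (h ▸ hvK)
      have hc2 : PO G {x}ᶜ (Function.update c v (c x)) := by
        have hv1 : ∀ b, b ≠ x → G.Adj v b → c b ≠ c x :=
          fun b hb hvb h => hb (hKu x hx hxv b hvb h)
        intro a ha b hb hab
        by_cases hav : a = v
        · subst hav
          simp only [Function.update_self, Function.update_of_ne hab.ne']
          exact (hv1 b hb hab).symm
        · by_cases hbv : b = v
          · subst hbv
            simp only [Function.update_self, Function.update_of_ne hav]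
            exact hv1 a ha hab.symm
          · simp only [Function.update_of_ne hav, Function.update_of_ne hbv]
            exact hc a hav b hbv hab
      have hmx : c z ≠ c x := (hc x hxv z hzv hxz).symm
      obtain ⟨r, hvr, hrc⟩ := surj H v c hc (c z)
      have hrK : r ∈ K := by
        rw [hKmem]
        refine Or.inr ⟨?_, ?_, hvr⟩
        · rintro rfl
          exact hzc (by rw [← hrc, hcw])
        · rintro rfl
          exact hzc hrc.symm
      have hrx : r ≠ x := by
        rintro rfl
        exact hmx hrc.symm
      have hrz : r ≠ z := fun h => hz (h ▸ hrK)
      have hrv : r ≠ v := hvr.ne'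
      have huq := uniq_of_pair H x _ hc2 r z hrz (hKadj x hx r hrK hrx.symm) hxz
        (by simp only [Function.update_of_ne hrv, Function.update_of_ne hzv]; exact hrc)
      obtain ⟨q, hxq, hqc⟩ := surj H x _ hc2 (c w)
      have hqv : q ≠ v := by
        rintro rfl
        simp only [Function.update_self] at hqc
        exact hK0 x hx hxv hqc
      simp only [Function.update_of_ne hqv] at hqc
      have hqK : q ∉ K := fun h => hK0 q h hqv hqc
      have hqz : q ≠ z := by
        rintro rfl
        exact hzc hqc
      have hqr : q ≠ r := fun h => hqK (h ▸ hrK)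
      have hsub : K.erase r ⊆ K.filter (G.Adj q) := by
        intro t ht
        rw [Finset.mem_erase] at ht
        rw [Finset.mem_filter]
        refine ⟨ht.2, ?_⟩
        by_cases htx : t = x
        · rw [htx]; exact hxq.symm
        · have hxt := hKadj x hx t ht.2 (Ne.symm htx)
          have htz : t ≠ z := fun h => hz (h ▸ ht.2)
          exact uniq_adj H x _ hc2 q t hxq hxt (fun h => hqK (h ▸ ht.2))
            (huq q hxq hqr hqz) (huq t hxt ht.1 htz)
      have h1 := Finset.card_le_card hsub
      rw [Finset.card_erase_of_mem hrK, hK.card_eq] at h1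
      have := hno K hK q hqK
      omega
  -- outer neighbours have at most two neighbours in `K`
  have hfew : ∀ z, z ∉ K → (K.filter (G.Adj z)).card ≤ 2 := by
    intro z hz
    obtain ⟨_, z1, z2, _, _, _, _, _, _, hL⟩ := struct H z
    obtain ⟨L, hLdef⟩ : ∃ L, L = insert z (((G.neighborFinset z).erase z1).erase z2) := ⟨_, rfl⟩
    rw [← hLdef] at hL
    have hzL : z ∈ L := by rw [hLdef]; simp
    by_cases hmeet : ∃ x ∈ K, x ∈ L
    · exfalso
      obtain ⟨x, hxK, hxL⟩ := hmeet
      have hxz : x ≠ z := fun h => hz (h ▸ hxK)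
      have hxz' : G.Adj x z := hL.isClique hxL hzL hxz
      have hsub : L ⊆ insert z (K.filter (G.Adj z)) := by
        intro t ht
        rw [Finset.mem_insert, Finset.mem_filter]
        by_cases htz : t = z
        · exact Or.inl htz
        · have hzt : G.Adj z t := hL.isClique hzL ht (Ne.symm htz)
          refine Or.inr ⟨?_, hzt⟩
          by_contra htK
          have hxt : G.Adj x t := hL.isClique hxL ht (fun h => htK (h ▸ hxK))
          have e1 := hout x hxK t htK hxt
          have e2 := hout x hxK z hz hxz'
          exact hc z (fun h => hz (by rw [h]; exact hvK)) t (fun h => htK (by rw [h]; exact hvK))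
            hzt (e2.trans e1.symm)
      have h1 := (Finset.card_le_card hsub).trans (Finset.card_insert_le _ _)
      rw [hL.card_eq] at h1
      have := hno K hK z hz
      omega
    · push Not at hmeet
      have hdisj : Disjoint (L.erase z) (K.filter (G.Adj z)) := by
        rw [Finset.disjoint_left]
        intro t ht ht'
        exact hmeet t (Finset.mem_filter.1 ht').1 (Finset.mem_erase.1 ht).2
      have hsub : (L.erase z) ∪ (K.filter (G.Adj z)) ⊆ G.neighborFinset z := by
        intro t ht
        rw [SimpleGraph.mem_neighborFinset]
        rw [Finset.mem_union, Finset.mem_erase, Finset.mem_filter] at ht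
        rcases ht with ht | ht
        · exact hL.isClique hzL ht.2 ht.1.symm
        · exact ht.2
      have h1 := Finset.card_le_card hsub
      rw [Finset.card_union_of_disjoint hdisj, Finset.card_erase_of_mem hzL, hL.card_eq,
        SimpleGraph.card_neighborFinset_eq_degree, deg_ge H z] at h1
      omega
  obtain ⟨x, hxK, hxw, hxw'⟩ : ∃ x ∈ K, ¬ G.Adj w x ∧ ¬ G.Adj w' x := by
    by_contra hcon
    push Not at hcon
    have hsub : K ⊆ K.filter (G.Adj w) ∪ K.filter (G.Adj w') := by
      intro t ht
      rw [Finset.mem_union, Finset.mem_filter, Finset.mem_filter]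
      by_cases h : G.Adj w t
      · exact Or.inl ⟨ht, h⟩
      · exact Or.inr ⟨ht, hcon t ht h⟩
    have h1 := (Finset.card_le_card hsub).trans (Finset.card_union_le _ _)
    have h2 := hfew w hwK
    have h3 := hfew w' hwK'
    rw [hK.card_eq] at h1
    omega
  have hxv : x ≠ v := by
    rintro rfl
    exact hxw hw.symm
  have h0x := hK0 x hxK hxv
  obtain ⟨j, hj⟩ : ∃ j, j ≠ c w := ⟨c x, h0x⟩
  have hvout : ∀ z, z ∉ K → G.Adj v z → z = w ∨ z = w' := by
    intro z hz hvz
    rw [hKmem] at hz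
    tauto
  obtain ⟨c', hc', h1, h2, _, h4⟩ := kempe G H.hG {z | z ∉ K} c
    (fun a ha b hb hab => hc a (fun h => ha (by rw [h]; exact hvK)) b
      (fun h => hb (by rw [h]; exact hvK)) hab) (c w) j v {x}
    (by simpa using hvK)
    (by
      intro a ha hva
      rw [hout v hvK a ha hva]
      exact hj.symm)
    (by
      rintro x' rfl
      refine ⟨by simpa using hxK, hKadj v hvK x' hxK hxv.symm, ?_, ?_⟩
      · intro a ha hxa
        rw [hout x' hxK a ha hxa]
        exact hj.symm
      · intro a ha hva hxa
        rcases hvout a ha hva with rfl | rfl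
        · exact absurd hxa.symm hxw
        · exact absurd hxa.symm hxw')
  obtain ⟨e, he⟩ : ∃ e : V → Fin k, ∀ z, e z = Equiv.swap j (c x) (if z = v then c w else c z) :=
    ⟨_, fun _ => rfl⟩
  have hev : e v = c w := by
    rw [he]
    simp only [if_true]
    exact Equiv.swap_apply_of_ne_of_ne hj.symm h0x.symm
  have hex : e x = j := by
    rw [he]
    simp [hxv]
  have heinj : ∀ a ∈ K, ∀ b ∈ K, e a = e b → a = b := by
    intro a ha b hb h
    rw [he, he] at h
    have h := (Equiv.swap j (c x)).injective h
    by_cases hav : a = v <;> by_cases hbv : b = v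
    · rw [hav, hbv]
    · simp only [hav, hbv, if_true, if_false] at h
      exact absurd h.symm (hK0 b hb hbv)
    · simp only [hav, hbv, if_true, if_false] at h
      exact absurd h (hK0 a ha hav)
    · simp only [hav, hbv, if_false] at h
      exact hKinj b hb hbv a ha hav h
  have hcross : ∀ a ∈ K, ∀ b, b ∉ K → G.Adj a b → e a ≠ c' b := by
    intro a ha b hb hab
    have hb0 := hout a ha b hb hab
    by_cases hav : a = v
    · subst hav
      rw [hev, h1 b hb hab hb0]
      exact hj.symm
    · by_cases hax : a = x
      · subst hax
        rw [hex, h2 a rfl b hb hab hb0]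
        exact hj
      · have e1 : e a ≠ c w := fun h => hav (heinj a ha v hvK (h.trans hev.symm))
        have e2 : e a ≠ j := fun h => hax (heinj a ha x hxK (h.trans hex.symm))
        rcases h4 b (Or.inl hb0) with h | h <;> rw [h] <;> assumption
  refine H.hnon ⟨fun z => if z ∈ K then e z else c' z, ?_⟩
  intro a _ b _ hab
  by_cases ha : a ∈ K <;> by_cases hb : b ∈ K <;> simp only [ha, hb, if_true, if_false]
  · exact fun h => hab.ne (heinj a ha b hb h)
  · exact hcross a ha b hb hab
  · exact (hcross b hb a ha hab.symm).symm
  · exact hc' a ha b hb hab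

theorem no_crit (H : Crit G k) : False := by
  by_cases h : ∃ K : Finset V, G.IsNClique k K ∧ ∃ w, w ∉ K ∧ k ≤ (K.filter (G.Adj w)).card + 1
  · obtain ⟨K, hK, w, hw, hc⟩ := h
    exact case_two H K hK w hw hc
  · push Not at h
    have hne : Nonempty V := by
      by_contra hcon
      rw [not_nonempty_iff] at hcon
      exact H.hnon ⟨fun v => isEmptyElim v, fun a => isEmptyElim a⟩
    obtain ⟨v⟩ := hne
    exact case_one H (fun K hK w hw => h K hK w hw) v

end

theorem colour {V : Type*} [Fintype V] (G : SimpleGraph V) [DecidableRel G.Adj] (k : ℕ)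
    (hk : 5 ≤ k) (hG : ¬ G.HasOddHole) (hdeg : ∀ v, G.degree v ≤ k + 1)
    (hcl : G.CliqueFree (k + 1)) : G.Colorable k := by
  classical
  suffices h : ∃ c : V → Fin k, PO G Set.univ c by
    obtain ⟨c, hc⟩ := h
    exact ⟨SimpleGraph.Coloring.mk c (fun {a b} hab => hc a trivial b trivial hab)⟩
  by_contra hnon
  obtain ⟨S, hS⟩ := (Set.toFinite {S : Set V | ¬ ∃ c : V → Fin k, PO G S c}).exists_minimal
    ⟨Set.univ, hnon⟩
  have hSn : ¬ ∃ c : V → Fin k, PO G S c := hS.1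
  refine no_crit (G := G.induce S) (k := k) ⟨hk, ?_, ?_, ?_, ?_, ?_⟩
  · rintro ⟨n, h1, h2, ⟨f⟩⟩
    exact hG ⟨n, h1, h2, ⟨f.trans (SimpleGraph.Embedding.induce S)⟩⟩
  · intro v
    refine le_trans ?_ (hdeg v.1)
    rw [← SimpleGraph.card_neighborFinset_eq_degree, ← SimpleGraph.card_neighborFinset_eq_degree]
    refine Finset.card_le_card_of_injOn (fun z => z.1) ?_ ?_
    · intro z hz
      simpa using hz
    · intro a _ b _ h
      exact Subtype.ext h
  · exact hcl.comap ⟨(SimpleGraph.Embedding.induce (G := G) S).toCopy⟩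
  · intro T hT
    by_contra hcon
    have hsub : S ⊆ Subtype.val '' T := by
      refine hS.2 ?_ (by rintro _ ⟨x, _, rfl⟩; exact x.2)
      rintro ⟨c, hc⟩
      exact hcon ⟨fun z => c z.1, fun a ha b hb hab =>
        hc a.1 ⟨a, ha, rfl⟩ b.1 ⟨b, hb, rfl⟩ (by simpa using hab)⟩
    apply hT
    ext z
    simp only [Set.mem_univ, iff_true]
    obtain ⟨z', hz', he⟩ := hsub z.2
    rwa [← Subtype.ext he]
  · rintro ⟨c, hc⟩
    refine hSn ⟨fun z => if h : z ∈ S then c ⟨z, h⟩ else ⟨0, by omega⟩, ?_⟩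
    intro a ha b hb hab
    simp only [ha, hb, dif_pos]
    exact hc ⟨a, ha⟩ trivial ⟨b, hb⟩ trivial (by simpa using hab)

end BK

/-- If `G` is a finite simple odd-hole-free graph with `Δ(G) ≥ 7`,
then `χ(G) ≤ max (Δ(G) - 1) (ω(G))`. -/
theorem statement_1 {V : Type*} [Fintype V] (G : SimpleGraph V) [DecidableRel G.Adj]
    (hfree : ¬ G.HasOddHole) (hΔ : 7 ≤ G.maxDegree) :
    G.chromaticNumber ≤ (max (G.maxDegree - 1) G.cliqueNum : ℕ) := by
  have hcol : G.Colorable (max (G.maxDegree - 1) G.cliqueNum) := by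
    refine BK.colour G _ ?_ hfree ?_ ?_
    · have := le_max_left (G.maxDegree - 1) G.cliqueNum
      omega
    · intro v
      have := le_max_left (G.maxDegree - 1) G.cliqueNum
      have := G.degree_le_maxDegree v
      omega
    · intro s hs
      have h1 := hs.isClique.card_le_cliqueNum
      rw [hs.card_eq] at h1
      have := le_max_right (G.maxDegree - 1) G.cliqueNum
      omega
  exact hcol.chromaticNumber_le
end
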